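/- arXiv:1211.3224 — 2 statements merged into one kernel-verified Lean document; each statement's English description precedes it below -/
import Mathlib

section
/- Fix an integer d ≥ 2 and σ > 0, and let the noise distribution be Gaussian, ν = N(0,σ²). Let α = 1/2 − (ln 2)/(2 ln 3). Then for every integer r ≥ d+1 there exists n₀ (depending only on d and σ) such that for every n ≥ n₀ and every set estimator Ĝ based on n observations: sup_{P ∈ 𝒫_r} E_{μ_P^{⊗n}}[ |Ĝ △ P| ] ≥ α² σ² ln n / n. -/
open MeasureTheory Set Real Pointwise ProbabilityTheory

noncomputable section

/-- The unit cube `[0,1]^d`. -/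
def cube (d : ℕ) : Set (EuclideanSpace ℝ (Fin d)) := {x | ∀ i, x i ∈ Set.Icc (0:ℝ) 1}

/-- Volume of the unit Euclidean ball in dimension `d`. -/
def unitBallVol (d : ℕ) : ℝ :=
  (volume (Metric.closedBall (0 : EuclideanSpace ℝ (Fin d)) 1)).toReal

/-- Law of one observation `(X, 1_G(X) + ξ)`. -/
def regMeasure (d : ℕ) (ν : Measure ℝ) (G : Set (EuclideanSpace ℝ (Fin d))) :
    Measure (EuclideanSpace ℝ (Fin d) × ℝ) :=
  Measure.map (fun p => (p.1, G.indicator (fun _ => (1:ℝ)) p.1 + p.2))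
    ((volume.restrict (cube d)).prod ν)

/-- Law of `n` i.i.d. observations. -/
def sampleLaw (d n : ℕ) (ν : Measure ℝ) (G : Set (EuclideanSpace ℝ (Fin d))) :
    Measure (Fin n → EuclideanSpace ℝ (Fin d) × ℝ) :=
  Measure.pi (fun _ => regMeasure d ν G)

/-- Assumption A : σ-subgaussian noise. -/
def SubGaussian (ν : Measure ℝ) (σ : ℝ) : Prop :=
  ∀ u : ℝ, ∫ t, Real.exp (u * t) ∂ν ≤ Real.exp (u^2 * σ^2 / 2)

/-- Polytopes in `[0,1]^d` with at most `r` vertices. -/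
def polytopes (d r : ℕ) : Set (Set (EuclideanSpace ℝ (Fin d))) :=
  {P | ∃ V : Finset (EuclideanSpace ℝ (Fin d)), V.card ≤ r ∧ ↑V ⊆ cube d ∧
    P = convexHull ℝ (V : Set (EuclideanSpace ℝ (Fin d)))}

/-- Polytopes in `[0,1]^d` with at most `r` vertices whose coordinates are
integer multiples of `1/n`. -/
def gridPolytopes (d r n : ℕ) : Set (Set (EuclideanSpace ℝ (Fin d))) :=
  {P | ∃ V : Finset (EuclideanSpace ℝ (Fin d)), V.card ≤ r ∧ ↑V ⊆ cube d ∧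
    (∀ v ∈ V, ∀ i, ∃ k : ℤ, v i = k / n) ∧
    P = convexHull ℝ (V : Set (EuclideanSpace ℝ (Fin d)))}

/-- Compact convex subsets of `[0,1]^d`. -/
def convexSets (d : ℕ) : Set (Set (EuclideanSpace ℝ (Fin d))) :=
  {C | Convex ℝ C ∧ IsCompact C ∧ C ⊆ cube d}

/-- Least squares criterion. -/
def crit {d n : ℕ} (P : Set (EuclideanSpace ℝ (Fin d)))
    (ω : Fin n → EuclideanSpace ℝ (Fin d) × ℝ) : ℝ :=
  ∑ i, (1 - 2 * (ω i).2) * P.indicator (fun _ => (1:ℝ)) (ω i).1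

/-- `hatP` is a least squares estimator over `𝒫_r^{(n)}`. -/
def IsLSE (d r n : ℕ)
    (hatP : (Fin n → EuclideanSpace ℝ (Fin d) × ℝ) → Set (EuclideanSpace ℝ (Fin d))) :
    Prop :=
  (∀ ω, hatP ω ∈ gridPolytopes d r n ∧ ∀ Q ∈ gridPolytopes d r n, crit (hatP ω) ω ≤ crit Q ω)
  ∧ Measurable (fun p : (EuclideanSpace ℝ (Fin d)) × (Fin n → EuclideanSpace ℝ (Fin d) × ℝ) =>
      (hatP p.2).indicator (fun _ => (1:ℝ)) p.1)

/-- A set estimator : measurable set-valued map with values Borel subsets of the cube. -/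
def IsSetEstimator (d n : ℕ)
    (hatG : (Fin n → EuclideanSpace ℝ (Fin d) × ℝ) → Set (EuclideanSpace ℝ (Fin d))) :
    Prop :=
  (∀ ω, hatG ω ⊆ cube d ∧ MeasurableSet (hatG ω))
  ∧ Measurable (fun p : (EuclideanSpace ℝ (Fin d)) × (Fin n → EuclideanSpace ℝ (Fin d) × ℝ) =>
      (hatG p.2).indicator (fun _ => (1:ℝ)) p.1)

/-- Nikodym (pseudo-)distance : Lebesgue measure of the symmetric difference. -/
def sdVol {d : ℕ} (G₁ G₂ : Set (EuclideanSpace ℝ (Fin d))) : ℝ :=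
  (volume (symmDiff G₁ G₂)).toReal

theorem lintegral_pi_prod_eq_prod_lintegral {Ω : Type*} [MeasurableSpace Ω] (μ : Measure Ω)
    [SigmaFinite μ] {n : ℕ} {f : Fin n → Ω → ENNReal} (hf : ∀ i, Measurable (f i)) :
    ∫⁻ ω : Fin n → Ω, ∏ i, f i (ω i) ∂(Measure.pi fun _ => μ) = ∏ i, ∫⁻ x, f i x ∂μ := by
  induction n with
  | zero => simp
  | succ n ih =>
    have hm : Measurable fun ω : Fin n → Ω => ∏ i, f (Fin.succ i) (ω i) :=
      Finset.measurable_prod _ fun i _ => (hf _).comp (measurable_pi_apply i)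
    rw [← ((measurePreserving_piFinSuccAbove (fun _ => μ) 0).symm).lintegral_comp_emb
      (MeasurableEquiv.measurableEmbedding _)]
    simp_rw [MeasurableEquiv.piFinSuccAbove_symm_apply, Fin.insertNthEquiv, Fin.prod_univ_succ,
      Fin.insertNth_zero, Equiv.coe_fn_mk, Fin.cons_succ, cast_eq, Fin.cons_zero]
    rw [lintegral_prod_mul (hf 0).aemeasurable hm.aemeasurable, ih fun i => hf _]

theorem lintegral_pi_prod_eq_pow {Ω : Type*} [MeasurableSpace Ω] (μ : Measure Ω) [SigmaFinite μ]
    {f : Ω → ENNReal} (hf : Measurable f) (n : ℕ) :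
    ∫⁻ ω : Fin n → Ω, ∏ i, f (ω i) ∂(Measure.pi fun _ => μ) = (∫⁻ x, f x ∂μ) ^ n := by
  simpa using lintegral_pi_prod_eq_prod_lintegral μ (n := n) fun _ => hf

theorem pi_withDensity {Ω : Type*} [MeasurableSpace Ω] (μ : Measure Ω) [SigmaFinite μ]
    {f : Ω → ENNReal} (hf : Measurable f) [SigmaFinite (μ.withDensity f)] (n : ℕ) :
    (Measure.pi fun _ : Fin n => μ.withDensity f)
      = (Measure.pi fun _ : Fin n => μ).withDensity fun ω => ∏ i, f (ω i) := by
  refine Measure.pi_eq fun s hs => ?_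
  rw [withDensity_apply _ (MeasurableSet.univ_pi hs),
    ← lintegral_indicator (MeasurableSet.univ_pi hs)]
  have h : ∀ ω : Fin n → Ω, (univ.pi s).indicator (fun ω => ∏ i, f (ω i)) ω
      = ∏ i, (s i).indicator f (ω i) := by
    intro ω
    by_cases hω : ω ∈ univ.pi s
    · rw [indicator_of_mem hω]
      exact Finset.prod_congr rfl fun i _ => (indicator_of_mem (hω i (mem_univ i)) f).symm
    · rw [indicator_of_notMem hω]
      simp only [Set.mem_pi, mem_univ, true_implies, not_forall] at hω
      obtain ⟨i, hi⟩ := hω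
      exact (Finset.prod_eq_zero (Finset.mem_univ i) (indicator_of_notMem hi f)).symm
  simp_rw [h]
  rw [lintegral_pi_prod_eq_prod_lintegral μ fun i => hf.indicator (hs i)]
  refine Finset.prod_congr rfl fun i _ => ?_
  rw [lintegral_indicator (hs i), withDensity_apply _ (hs i)]

/-- Change of measure for a bounded statistic of an i.i.d. sample: the likelihood ratio is
truncated at `K` and its tail is controlled by the moment of order `1 + l`. -/
theorem lintegral_pi_withDensity_le {Ω : Type*} [MeasurableSpace Ω] (μ : Measure Ω) [SigmaFinite μ]
    {f : Ω → ENNReal} (hf : Measurable f) [SigmaFinite (μ.withDensity f)] (n : ℕ)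
    {g : (Fin n → Ω) → ENNReal} (hg : Measurable g) {v : ENNReal} (hgv : ∀ ω, g ω ≤ v)
    {K l : ℝ} (hK : 0 < K) (hl : 0 ≤ l) :
    ∫⁻ ω, g ω ∂(Measure.pi fun _ : Fin n => μ.withDensity f)
      ≤ ENNReal.ofReal K * ∫⁻ ω, g ω ∂(Measure.pi fun _ : Fin n => μ)
        + v * ENNReal.ofReal (K ^ (-l)) * (∫⁻ x, f x ^ (1 + l) ∂μ) ^ n := by
  have hL : Measurable fun ω : Fin n → Ω => ∏ i, f (ω i) :=
    Finset.measurable_prod _ fun i _ => hf.comp (measurable_pi_apply i)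
  have hpw : Measurable fun x => f x ^ (1 + l) := hf.pow_const _
  have hLp : Measurable fun ω : Fin n → Ω => ∏ i, f (ω i) ^ (1 + l) :=
    Finset.measurable_prod _ fun i _ => hpw.comp (measurable_pi_apply i)
  rw [pi_withDensity μ hf, lintegral_withDensity_eq_lintegral_mul _ hL hg,
    ← lintegral_pi_prod_eq_pow μ hpw, ← lintegral_const_mul _ hg, ← lintegral_const_mul _ hLp,
    ← lintegral_add_left (hg.const_mul _)]
  refine lintegral_mono fun ω => ?_
  simp only [Pi.mul_apply]
  rw [ENNReal.prod_rpow_of_nonneg (by linarith)]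
  set L := ∏ i, f (ω i)
  rcases le_total L (ENNReal.ofReal K) with h | h
  · exact (mul_le_mul_left h _).trans le_self_add
  · refine le_trans ?_ le_add_self
    have hK' : ENNReal.ofReal K ≠ 0 := by simpa using hK
    have h1 : 1 ≤ ENNReal.ofReal (K ^ (-l)) * L ^ l := by
      rw [← ENNReal.ofReal_rpow_of_pos hK, ENNReal.rpow_neg]
      calc (1 : ENNReal) = (ENNReal.ofReal K ^ l)⁻¹ * ENNReal.ofReal K ^ l := by
            rw [ENNReal.inv_mul_cancel]
            · simp [ENNReal.rpow_eq_zero_iff, hK.not_ge, hl.not_gt]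
            · exact ENNReal.rpow_ne_top_of_nonneg hl ENNReal.ofReal_ne_top
        _ ≤ _ := by gcongr
    calc L * g ω ≤ L * v := by gcongr; exact hgv ω
      _ = v * 1 * L := by ring
      _ ≤ v * (ENNReal.ofReal (K ^ (-l)) * L ^ l) * L := by gcongr
      _ = v * ENNReal.ofReal (K ^ (-l)) * (L * L ^ l) := by ring
      _ ≤ _ := by
        rw [ENNReal.rpow_add_of_nonneg _ _ zero_le_one hl, ENNReal.rpow_one]

/-- The Gaussian density ratio of `N(a, v)` with respect to `N(0, v)`. -/
def gaussianShiftDensity (v a y : ℝ) : ENNReal := ENNReal.ofReal (exp ((a * y - a ^ 2 / 2) / v))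

theorem gaussianReal_map_const_add_eq_withDensity {v : NNReal} (hv : v ≠ 0) (a : ℝ) :
    (gaussianReal 0 v).map (a + ·) = (gaussianReal 0 v).withDensity (gaussianShiftDensity v a) := by
  have hm : Measurable (gaussianShiftDensity v a) := by unfold gaussianShiftDensity; fun_prop
  rw [gaussianReal_map_const_add, gaussianReal_of_var_ne_zero _ hv,
    gaussianReal_of_var_ne_zero _ hv,
    ← withDensity_mul _ (measurable_gaussianPDF _ _) hm]
  congr 1
  funext y
  have hv' : (v : ℝ) ≠ 0 := by exact_mod_cast hv
  rw [Pi.mul_apply, gaussianPDF, gaussianPDF, gaussianShiftDensity,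
    ← ENNReal.ofReal_mul (gaussianPDFReal_nonneg _ _ _)]
  congr 1
  rw [gaussianPDFReal, gaussianPDFReal, mul_assoc (√(2 * π * v))⁻¹, ← exp_add]
  congr 2
  field_simp
  ring

theorem lintegral_gaussianShiftDensity {v : NNReal} (hv : v ≠ 0) (a : ℝ) :
    ∫⁻ y, gaussianShiftDensity v a y ∂(gaussianReal 0 v) = 1 := by
  have h := congrArg (fun μ => μ univ) (gaussianReal_map_const_add_eq_withDensity hv a)
  simp only [gaussianReal_map_const_add, measure_univ, withDensity_apply _ MeasurableSet.univ,
    Measure.restrict_univ] at h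
  exact h.symm

/-- The density of the law of one observation under `G` with respect to its law under `∅`. -/
def regDensity {d : ℕ} (v : ℝ) (G : Set (EuclideanSpace ℝ (Fin d)))
    (p : EuclideanSpace ℝ (Fin d) × ℝ) : ENNReal :=
  gaussianShiftDensity v (G.indicator (fun _ => (1 : ℝ)) p.1) p.2

theorem measurable_regDensity {d : ℕ} (v : ℝ) {G : Set (EuclideanSpace ℝ (Fin d))}
    (hG : MeasurableSet G) : Measurable (regDensity v G) := by
  have h : Measurable (G.indicator (fun _ => (1 : ℝ))) := measurable_const.indicator hG
  unfold regDensity gaussianShiftDensity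
  fun_prop

theorem measurableSet_cube (d : ℕ) : MeasurableSet (cube d) := by
  have : cube d = ⋂ i, (fun x : EuclideanSpace ℝ (Fin d) => x i) ⁻¹' Icc 0 1 := by
    ext x; simp [cube]
  rw [this]
  exact MeasurableSet.iInter fun i => measurableSet_Icc.preimage (by fun_prop)

theorem volume_cube (d : ℕ) : volume (cube d) = 1 := by
  have h : cube d = WithLp.ofLp ⁻¹' (univ.pi fun _ : Fin d => Icc (0 : ℝ) 1) := by
    ext x; simp only [cube, mem_ofPred_eq, mem_preimage, mem_univ_pi]
  rw [h, (PiLp.volume_preserving_ofLp (Fin d)).measure_preimage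
    (MeasurableSet.univ_pi fun _ => measurableSet_Icc).nullMeasurableSet]
  rw [volume_pi_pi]
  simp

instance isProbabilityMeasure_restrict_cube (d : ℕ) :
    IsProbabilityMeasure (volume.restrict (cube d)) :=
  ⟨by rw [Measure.restrict_apply_univ, volume_cube]⟩

theorem regMeasure_empty (d : ℕ) (ν : Measure ℝ) [SFinite ν] :
    regMeasure d ν ∅ = (volume.restrict (cube d)).prod ν := by
  simp [regMeasure]

theorem measurable_regression_map {d : ℕ} {G : Set (EuclideanSpace ℝ (Fin d))}
    (hG : MeasurableSet G) :
    Measurable fun p : EuclideanSpace ℝ (Fin d) × ℝ =>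
      (p.1, G.indicator (fun _ => (1 : ℝ)) p.1 + p.2) := by
  have h : Measurable (G.indicator (fun _ => (1 : ℝ))) := measurable_const.indicator hG
  fun_prop

theorem isProbabilityMeasure_regMeasure {d : ℕ} (ν : Measure ℝ) [IsProbabilityMeasure ν]
    {G : Set (EuclideanSpace ℝ (Fin d))} (hG : MeasurableSet G) :
    IsProbabilityMeasure (regMeasure d ν G) :=
  Measure.isProbabilityMeasure_map (measurable_regression_map hG).aemeasurable

theorem regMeasure_eq_withDensity {d : ℕ} {v : NNReal} (hv : v ≠ 0)
    {G : Set (EuclideanSpace ℝ (Fin d))} (hG : MeasurableSet G) :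
    regMeasure d (gaussianReal 0 v) G
      = (regMeasure d (gaussianReal 0 v) ∅).withDensity (regDensity v G) := by
  ext s hs
  rw [regMeasure_empty, withDensity_apply _ hs, ← lintegral_indicator hs,
    lintegral_prod _ ((measurable_regDensity v hG).indicator hs).aemeasurable, regMeasure,
    Measure.map_apply (measurable_regression_map hG) hs,
    Measure.prod_apply (measurable_regression_map hG hs)]
  refine lintegral_congr fun x => ?_
  have hsx : MeasurableSet (Prod.mk x ⁻¹' s) := measurable_prodMk_left hs
  have h := congrArg (fun μ => μ (Prod.mk x ⁻¹' s))
    (gaussianReal_map_const_add_eq_withDensity hv (G.indicator (fun _ => (1 : ℝ)) x))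
  rw [Measure.map_apply (by fun_prop) hsx, withDensity_apply _ hsx,
    ← lintegral_indicator hsx] at h
  exact h

theorem lintegral_gaussianShiftDensity_one_rpow {v : NNReal} (hv : v ≠ 0) {l : ℝ} (hl : 0 ≤ l) :
    ∫⁻ y, gaussianShiftDensity v 1 y ^ (1 + l) ∂(gaussianReal 0 v)
      = ENNReal.ofReal (exp ((l ^ 2 + l) / (2 * v))) := by
  have hv' : (v : ℝ) ≠ 0 := by exact_mod_cast hv
  have h : ∀ y, gaussianShiftDensity v 1 y ^ (1 + l)
      = ENNReal.ofReal (exp ((l ^ 2 + l) / (2 * v))) * gaussianShiftDensity v (1 + l) y := by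
    intro y
    rw [gaussianShiftDensity, gaussianShiftDensity,
      ENNReal.ofReal_rpow_of_nonneg (exp_pos _).le (by linarith), ← exp_mul,
      ← ENNReal.ofReal_mul (exp_pos _).le, ← exp_add]
    congr 2
    field_simp
    ring
  simp_rw [h]
  rw [lintegral_const_mul _ (by unfold gaussianShiftDensity; fun_prop),
    lintegral_gaussianShiftDensity hv, mul_one]

theorem lintegral_regDensity_rpow_le {d : ℕ} {v : NNReal} (hv : v ≠ 0)
    {G : Set (EuclideanSpace ℝ (Fin d))} (hG : MeasurableSet G) {l : ℝ} (hl : 0 ≤ l) (hl1 : l ≤ 1)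
    (hlv : l ≤ v) :
    ∫⁻ p, regDensity v G p ^ (1 + l) ∂(regMeasure d (gaussianReal 0 v) ∅)
      ≤ 1 + ENNReal.ofReal (2 * l / v) * volume G := by
  have hv' : (0 : ℝ) < v := lt_of_le_of_ne v.coe_nonneg (by exact_mod_cast hv.symm)
  rw [regMeasure_empty,
    lintegral_prod _ ((measurable_regDensity _ hG).pow_const _).aemeasurable]
  have hexp : exp ((l ^ 2 + l) / (2 * v)) ≤ 1 + 2 * l / v := by
    have h0 : 0 ≤ (l ^ 2 + l) / (2 * v) := by positivity
    have h1 : (l ^ 2 + l) / (2 * v) ≤ l / v := by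
      rw [div_le_div_iff₀ (by positivity) hv']
      nlinarith [mul_nonneg (mul_nonneg hl hv'.le) (sub_nonneg.2 hl1)]
    have h2 : l / v ≤ 1 := (div_le_one hv').2 hlv
    have h3 := (abs_le.1 (abs_exp_sub_one_le (x := (l ^ 2 + l) / (2 * v))
      (by rw [abs_of_nonneg h0]; linarith))).2
    rw [abs_of_nonneg h0] at h3
    have h4 : 2 * l / v = 2 * (l / v) := by ring
    linarith
  calc _ ≤ ∫⁻ x in cube d, (1 + G.indicator (fun _ => ENNReal.ofReal (2 * l / v)) x) := by
        refine lintegral_mono fun x => ?_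
        by_cases hx : x ∈ G
        · simp only [regDensity, indicator_of_mem hx]
          rw [lintegral_gaussianShiftDensity_one_rpow hv hl, ← ENNReal.ofReal_one,
            ← ENNReal.ofReal_add zero_le_one (by positivity)]
          exact ENNReal.ofReal_le_ofReal hexp
        · simp [regDensity, indicator_of_notMem hx, gaussianShiftDensity]
    _ ≤ _ := by
        rw [lintegral_add_left measurable_const, lintegral_indicator hG]
        simp only [lintegral_const, measure_univ, mul_one]
        rw [Measure.restrict_apply_univ]
        gcongr
        exact Measure.restrict_le_self

/-- The vertices `0, e₁, …, e_d` of the standard corner simplex. -/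
def cornerVertices (d : ℕ) : Finset (EuclideanSpace ℝ (Fin d)) := by
  classical exact insert 0 (Finset.univ.image fun i => EuclideanSpace.single i 1)

/-- The corner simplex with vertices `0, e₁, …, e_d`. -/
def cornerSimplex (d : ℕ) : Set (EuclideanSpace ℝ (Fin d)) :=
  convexHull ℝ (cornerVertices d : Set (EuclideanSpace ℝ (Fin d)))

theorem card_cornerVertices_le (d : ℕ) : (cornerVertices d).card ≤ d + 1 := by
  classical
  unfold cornerVertices
  refine (Finset.card_insert_le _ _).trans ?_
  gcongr
  exact Finset.card_image_le.trans (by simp)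

theorem cornerVertices_subset_cube (d : ℕ) :
    (cornerVertices d : Set (EuclideanSpace ℝ (Fin d))) ⊆ cube d := by
  classical
  intro x hx
  simp only [cornerVertices, Finset.coe_insert, Finset.coe_image, Finset.coe_univ, image_univ,
    mem_insert_iff, mem_range] at hx
  rcases hx with rfl | ⟨i, rfl⟩ <;> intro k
  · simp
  · by_cases h : k = i <;> simp [h]

theorem convex_cube (d : ℕ) : Convex ℝ (cube d) := by
  intro x hx y hy a b ha hb hab i
  have h := convex_Icc (0 : ℝ) 1 (hx i) (hy i) ha hb hab
  simpa using h

theorem cornerSimplex_subset_cube (d : ℕ) : cornerSimplex d ⊆ cube d :=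
  convexHull_min (cornerVertices_subset_cube d) (convex_cube d)

theorem volume_cornerSimplex_pos {d : ℕ} (hd : 0 < d) : 0 < volume (cornerSimplex d) := by
  classical
  have hd' : (0 : ℝ) < d := by exact_mod_cast hd
  let U : Set (EuclideanSpace ℝ (Fin d)) := {x | ∀ i, x i ∈ Ioo (0 : ℝ) (1 / d)}
  have hU : IsOpen U := by
    simp only [U, ofPred_forall]
    exact isOpen_iInter_of_finite fun i => isOpen_Ioo.preimage (by fun_prop)
  have hne : U.Nonempty := by
    refine ⟨WithLp.toLp 2 fun _ => 1 / (2 * d), fun i => ⟨by simp; positivity, ?_⟩⟩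
    simp only
    gcongr
    linarith
  refine (hU.measure_pos _ hne).trans_le (measure_mono fun x hx => ?_)
  have h0 : (0 : EuclideanSpace ℝ (Fin d)) ∈ cornerSimplex d :=
    subset_convexHull _ _ (by simp [cornerVertices])
  have hi : ∀ i, EuclideanSpace.single i (1 : ℝ) ∈ cornerSimplex d := fun i =>
    subset_convexHull _ _ (by simp [cornerVertices])
  have hsum : ∑ i, x i ≤ 1 := by
    calc ∑ i, x i ≤ ∑ _i : Fin d, (1 / d : ℝ) := Finset.sum_le_sum fun i _ => (hx i).2.le
      _ = 1 := by simp [hd'.ne']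
  have hmem := (convex_convexHull ℝ (cornerVertices d : Set (EuclideanSpace ℝ (Fin d)))).sum_mem
    (t := Finset.univ) (w := fun o : Option (Fin d) => o.elim (1 - ∑ i, x i) x)
    (z := fun o => o.elim 0 fun i => EuclideanSpace.single i 1)
    (by rintro (_ | i) -
        · simpa using hsum
        · exact (hx i).1.le)
    (by simp [Fintype.sum_option])
    (by rintro (_ | i) -
        · exact h0
        · exact hi i)
  have hx' : x = ∑ o : Option (Fin d), (o.elim (1 - ∑ i, x i) x : ℝ) •
      (o.elim 0 fun i => EuclideanSpace.single i 1 : EuclideanSpace ℝ (Fin d)) := by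
    ext k
    simp [Fintype.sum_option, Pi.single_apply]
  rw [hx']
  exact hmem

theorem isCompact_cornerSimplex (d : ℕ) : IsCompact (cornerSimplex d) :=
  (Finset.finite_toSet _).isCompact_convexHull ℝ

/-- The linear map multiplying the coordinate `i₀` by `s`. -/
def scaleCoord {d : ℕ} (i₀ : Fin d) (s : ℝ) :
    EuclideanSpace ℝ (Fin d) →ₗ[ℝ] EuclideanSpace ℝ (Fin d) :=
  Matrix.toEuclideanLin (Matrix.diagonal (Function.update (1 : Fin d → ℝ) i₀ s))

theorem scaleCoord_apply {d : ℕ} (i₀ : Fin d) (s : ℝ) (x : EuclideanSpace ℝ (Fin d)) (i : Fin d) :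
    scaleCoord i₀ s x i = Function.update (1 : Fin d → ℝ) i₀ s i * x i := by
  simp [scaleCoord, Matrix.toLpLin_apply, Matrix.mulVec_diagonal]

theorem det_scaleCoord {d : ℕ} (i₀ : Fin d) (s : ℝ) : LinearMap.det (scaleCoord i₀ s) = s := by
  rw [scaleCoord, Matrix.toEuclideanLin_eq_toLin_orthonormal, LinearMap.det_toLin,
    Matrix.det_diagonal, Finset.prod_update_of_mem (Finset.mem_univ _)]
  simp

/-- The affine map `x ↦ x` with coordinate `i₀` replaced by `s * x i₀ + t`. -/
def slabMap {d : ℕ} (i₀ : Fin d) (s t : ℝ) :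
    EuclideanSpace ℝ (Fin d) →ᵃ[ℝ] EuclideanSpace ℝ (Fin d) :=
  (scaleCoord i₀ s).toAffineMap + AffineMap.const ℝ _ (EuclideanSpace.single i₀ t)

theorem slabMap_apply {d : ℕ} (i₀ : Fin d) (s t : ℝ) (x : EuclideanSpace ℝ (Fin d)) :
    slabMap i₀ s t x = scaleCoord i₀ s x + EuclideanSpace.single i₀ t := rfl

theorem slabMap_apply_self {d : ℕ} (i₀ : Fin d) (s t : ℝ) (x : EuclideanSpace ℝ (Fin d)) :
    slabMap i₀ s t x i₀ = s * x i₀ + t := by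
  simp [slabMap_apply, scaleCoord_apply]

theorem slabMap_apply_of_ne {d : ℕ} {i₀ i : Fin d} (h : i ≠ i₀) (s t : ℝ)
    (x : EuclideanSpace ℝ (Fin d)) : slabMap i₀ s t x i = x i := by
  simp [slabMap_apply, scaleCoord_apply, h]

theorem volume_slabMap_image {d : ℕ} (i₀ : Fin d) {s : ℝ} (hs : 0 ≤ s) (t : ℝ)
    (A : Set (EuclideanSpace ℝ (Fin d))) :
    volume (slabMap i₀ s t '' A) = ENNReal.ofReal s * volume A := by
  have h : slabMap i₀ s t '' A
      = (fun x => x + EuclideanSpace.single i₀ t) '' (scaleCoord i₀ s '' A) := by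
    rw [image_image]; rfl
  rw [h, image_add_right, measure_preimage_add_right, Measure.addHaar_image_linearMap,
    det_scaleCoord, abs_of_nonneg hs]

theorem slabMap_image_mem_polytopes {d : ℕ} (i₀ : Fin d) {s t : ℝ} (hs : 0 ≤ s) (ht : 0 ≤ t)
    (hst : s + t ≤ 1) : slabMap i₀ s t '' cornerSimplex d ∈ polytopes d (d + 1) := by
  classical
  refine ⟨(cornerVertices d).image (slabMap i₀ s t),
    Finset.card_image_le.trans (card_cornerVertices_le d), ?_, ?_⟩
  · rw [Finset.coe_image, image_subset_iff]
    intro x hx i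
    have hxi := cornerVertices_subset_cube d hx i
    by_cases h : i = i₀
    · subst h
      rw [slabMap_apply_self]
      constructor <;> nlinarith [hxi.1, hxi.2]
    · rwa [slabMap_apply_of_ne h]
  · rw [Finset.coe_image, cornerSimplex, AffineMap.image_convexHull]

/-- There are `M` disjoint simplices of volume `c / M` in the cube, with `c` depending only on
the dimension. -/
theorem exists_disjoint_simplices {d : ℕ} (hd : 0 < d) :
    ∃ c : ℝ, 0 < c ∧ ∀ M : ℕ, 0 < M → ∃ T : Fin M → Set (EuclideanSpace ℝ (Fin d)),
      (∀ j, T j ∈ polytopes d (d + 1)) ∧ Pairwise (fun j k => Disjoint (T j) (T k)) ∧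
      (∀ j, MeasurableSet (T j)) ∧ ∀ j, volume (T j) = ENNReal.ofReal (c / M) := by
  have hfin : volume (cornerSimplex d) ≠ ⊤ := (isCompact_cornerSimplex d).measure_lt_top.ne
  have hpos : 0 < (volume (cornerSimplex d)).toReal :=
    ENNReal.toReal_pos (volume_cornerSimplex_pos hd).ne' hfin
  refine ⟨(volume (cornerSimplex d)).toReal / 2, by positivity, fun M hM => ?_⟩
  have hM' : (0 : ℝ) < M := by exact_mod_cast hM
  let i₀ : Fin d := ⟨0, hd⟩
  have hmem : ∀ (j : Fin M) x, x ∈ slabMap i₀ (1 / (2 * M)) (j / M) '' cornerSimplex d →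
      (j / M : ℝ) ≤ x i₀ ∧ x i₀ < (j + 1) / M := by
    rintro j _ ⟨x, hx, rfl⟩
    have hxi := cornerSimplex_subset_cube d hx i₀
    rw [slabMap_apply_self]
    have h1 : 0 ≤ 1 / (2 * (M : ℝ)) * x i₀ := mul_nonneg (by positivity) hxi.1
    have h2 : 1 / (2 * (M : ℝ)) * x i₀ ≤ 1 / (2 * (M : ℝ)) * 1 := by gcongr; exact hxi.2
    have h3 : 1 / (2 * (M : ℝ)) * 1 < 1 / M := by
      rw [mul_one]; exact one_div_lt_one_div_of_lt hM' (by linarith)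
    refine ⟨by linarith, ?_⟩
    rw [add_div]
    linarith
  refine ⟨fun j => slabMap i₀ (1 / (2 * M)) (j / M) '' cornerSimplex d, fun j => ?_,
    fun j k hjk => ?_, fun j => ?_, fun j => ?_⟩
  · refine slabMap_image_mem_polytopes i₀ (by positivity) (by positivity) ?_
    have hj : (j : ℝ) + 1 ≤ M := by exact_mod_cast j.2
    rw [div_add_div _ _ (by positivity) hM'.ne', div_le_one (by positivity)]
    nlinarith
  · refine Set.disjoint_left.2 fun x hxj hxk => ?_
    obtain ⟨a1, a2⟩ := hmem j x hxj
    obtain ⟨b1, b2⟩ := hmem k x hxk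
    have h1 := (div_lt_div_iff_of_pos_right hM').1 (a1.trans_lt b2)
    have h2 := (div_lt_div_iff_of_pos_right hM').1 (b1.trans_lt a2)
    have h1' : (j : ℕ) < (k : ℕ) + 1 := by
      rw [← Nat.cast_lt (α := ℝ)]; push_cast; exact h1
    have h2' : (k : ℕ) < (j : ℕ) + 1 := by
      rw [← Nat.cast_lt (α := ℝ)]; push_cast; exact h2
    exact hjk (Fin.ext (by omega))
  · exact ((isCompact_cornerSimplex d).image
      (AffineMap.continuous_of_finiteDimensional _)).measurableSet
  · rw [volume_slabMap_image i₀ (by positivity), ← ENNReal.ofReal_toReal hfin,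
      ← ENNReal.ofReal_mul (by positivity), ENNReal.toReal_ofReal ENNReal.toReal_nonneg]
    congr 1
    field_simp

theorem measurable_volume_estimator_inter {d n : ℕ}
    {hatG : (Fin n → EuclideanSpace ℝ (Fin d) × ℝ) → Set (EuclideanSpace ℝ (Fin d))}
    (hG : IsSetEstimator d n hatG) {T : Set (EuclideanSpace ℝ (Fin d))} (hT : MeasurableSet T) :
    Measurable fun ω => volume (hatG ω ∩ T) := by
  have h1 : MeasurableSet {p : EuclideanSpace ℝ (Fin d) × (Fin n → EuclideanSpace ℝ (Fin d) × ℝ) |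
      p.1 ∈ hatG p.2} := by
    convert hG.2 (measurableSet_singleton (1 : ℝ)) using 1
    ext p
    by_cases hp : p.1 ∈ hatG p.2 <;> simp [hp]
  have h2 := measurable_measure_prodMk_right (μ := volume)
    (h1.inter (hT.preimage measurable_fst))
  exact h2

/-- Comparison of the null hypothesis `∅` with disjoint alternatives of equal volume `V`: on
average the estimator covers only a fraction `1 / M` of its null risk on each alternative. -/
theorem volume_le_of_risk_le {d n M : ℕ} (hM : 0 < M) {v : NNReal} (hv : v ≠ 0)
    {hatG : (Fin n → EuclideanSpace ℝ (Fin d) × ℝ) → Set (EuclideanSpace ℝ (Fin d))}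
    (hG : IsSetEstimator d n hatG) {T : Fin M → Set (EuclideanSpace ℝ (Fin d))}
    (hT : ∀ j, MeasurableSet (T j)) (hdisj : Pairwise fun j k => Disjoint (T j) (T k))
    {V R : ENNReal} (hV : ∀ j, volume (T j) = V)
    (hR₀ : ∫⁻ ω, volume (symmDiff (hatG ω) ∅) ∂sampleLaw d n (gaussianReal 0 v) ∅ ≤ R)
    (hR : ∀ j, ∫⁻ ω, volume (symmDiff (hatG ω) (T j))
      ∂sampleLaw d n (gaussianReal 0 v) (T j) ≤ R)
    {K l : ℝ} (hK : 0 < K) (hl : 0 ≤ l) (hl1 : l ≤ 1) (hlv : l ≤ v) :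
    V ≤ R + ENNReal.ofReal K * (R / M)
      + V * ENNReal.ofReal (K ^ (-l)) * (1 + ENNReal.ofReal (2 * l / v) * V) ^ n := by
  have hg : ∀ j, Measurable fun ω => volume (hatG ω ∩ T j) := fun j =>
    measurable_volume_estimator_inter hG (hT j)
  have : Nonempty (Fin M) := ⟨⟨0, hM⟩⟩
  obtain ⟨j, -, hj⟩ : ∃ j ∈ (Finset.univ : Finset (Fin M)),
      ∫⁻ ω, volume (hatG ω ∩ T j) ∂sampleLaw d n (gaussianReal 0 v) ∅ ≤ R / M := by
    by_contra! h
    refine (ENNReal.sum_lt_sum_of_nonempty Finset.univ_nonempty h).not_ge ?_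
    rw [← lintegral_finsetSum _ fun j _ => hg j]
    calc _ ≤ ∫⁻ ω, volume (symmDiff (hatG ω) ∅) ∂sampleLaw d n (gaussianReal 0 v) ∅ := by
          refine lintegral_mono fun ω => ?_
          rw [← measure_biUnion_finset
            (fun j _ k _ hjk => (hdisj hjk).mono inter_subset_right inter_subset_right)
            fun j _ => (hG.1 ω).2.inter (hT j)]
          refine measure_mono (iUnion₂_subset fun j _ => ?_)
          simp [← Set.bot_eq_empty]
      _ ≤ R := hR₀
      _ = _ := by
          rw [Finset.sum_const, Finset.card_univ, Fintype.card_fin, nsmul_eq_mul,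
            ENNReal.mul_div_cancel (by exact_mod_cast hM.ne') (ENNReal.natCast_ne_top M)]
  have hprob := isProbabilityMeasure_regMeasure (gaussianReal 0 v) (hT j)
  have hprob₀ := isProbabilityMeasure_regMeasure (d := d) (gaussianReal 0 v) MeasurableSet.empty
  have hd := regMeasure_eq_withDensity hv (hT j)
  have hd' : IsProbabilityMeasure
      ((regMeasure d (gaussianReal 0 v) ∅).withDensity (regDensity v (T j))) := hd ▸ hprob
  have hchange := lintegral_pi_withDensity_le (regMeasure d (gaussianReal 0 v) ∅)
    (measurable_regDensity v (hT j)) n (hg j) (v := V)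
    (fun ω => (measure_mono inter_subset_right).trans (hV j).le) hK hl
  rw [← hd] at hchange
  have hprobn : IsProbabilityMeasure (sampleLaw d n (gaussianReal 0 v) (T j)) := by
    unfold sampleLaw; infer_instance
  calc V = ∫⁻ _, V ∂sampleLaw d n (gaussianReal 0 v) (T j) := by simp
    _ ≤ ∫⁻ ω, (volume (hatG ω ∩ T j) + volume (symmDiff (hatG ω) (T j)))
          ∂sampleLaw d n (gaussianReal 0 v) (T j) := by
        refine lintegral_mono fun ω => ?_
        rw [← hV j]
        refine (measure_mono fun x hx => ?_).trans (measure_union_le _ _)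
        by_cases hxG : x ∈ hatG ω
        · exact Or.inl ⟨hxG, hx⟩
        · exact Or.inr (Or.inr ⟨hx, hxG⟩)
    _ = ∫⁻ ω, volume (hatG ω ∩ T j) ∂sampleLaw d n (gaussianReal 0 v) (T j)
          + ∫⁻ ω, volume (symmDiff (hatG ω) (T j)) ∂sampleLaw d n (gaussianReal 0 v) (T j) :=
        lintegral_add_left (hg j) _
    _ ≤ (ENNReal.ofReal K * (R / M)
          + V * ENNReal.ofReal (K ^ (-l)) * (1 + ENNReal.ofReal (2 * l / v) * V) ^ n) + R := by
        refine add_le_add (hchange.trans ?_) (hR j)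
        gcongr
        · exact hj
        · exact (lintegral_regDensity_rpow_le hv (hT j) hl hl1 hlv).trans_eq (by rw [hV])
    _ = _ := by ring

theorem sq_half_sub_log_ratio_le :
    (1 / 2 - Real.log 2 / (2 * Real.log 3)) ^ 2 ≤ (1 / 25 : ℝ) := by
  have h2 : 0 < Real.log 2 := Real.log_pos (by norm_num)
  have h3 : 0 < Real.log 3 := Real.log_pos (by norm_num)
  have hle : Real.log 2 ≤ Real.log 3 := Real.log_le_log (by norm_num) (by norm_num)
  have hge : 3 * Real.log 3 ≤ 5 * Real.log 2 := by
    have h := Real.log_le_log (x := 3 ^ 3) (y := 2 ^ 5) (by norm_num) (by norm_num)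
    rw [Real.log_pow, Real.log_pow] at h
    exact_mod_cast h
  have hu : Real.log 2 / (2 * Real.log 3) ≤ 1 / 2 := by
    rw [div_le_div_iff₀ (by positivity) (by norm_num)]; linarith
  have hl : 3 / 10 ≤ Real.log 2 / (2 * Real.log 3) := by
    rw [div_le_div_iff₀ (by norm_num) (by positivity)]; linarith
  nlinarith

/-- Choice of the number `M` of alternatives, as a function of the sample size. -/
theorem exists_card_alternatives {c s : ℝ} (hc : 0 < c) (hs : 0 < s) :
    ∃ n₀ : ℕ, ∀ n : ℕ, n₀ ≤ n → 0 < n ∧ ∃ M : ℕ, 0 < M ∧ ∀ r : ℝ, 0 ≤ r →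
      c / M ≤ r + √n * (r / M)
        + c / M * √n ^ (-min 1 s) * (1 + 2 * min 1 s / s * (c / M)) ^ n →
      1 / 25 * s * Real.log n / n ≤ r := by
  set l := min 1 s with hl_def
  have hl : 0 < l := lt_min one_pos hs
  have E1 : ∀ᶠ x : ℝ in Filter.atTop, s * Real.log x ≤ c * √x := by
    filter_upwards [(isLittleO_log_rpow_atTop (r := 1 / 2) (by norm_num)).def
      (div_pos hc hs), Filter.eventually_ge_atTop 1] with x hx hx1
    rw [Real.norm_of_nonneg (Real.log_nonneg hx1), ← Real.sqrt_eq_rpow,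
      Real.norm_of_nonneg (Real.sqrt_nonneg x)] at hx
    calc s * Real.log x ≤ s * (c / s * √x) := by gcongr
      _ = c * √x := by field_simp
  have E2 : ∀ᶠ x : ℝ in Filter.atTop, x ^ (-(l / 4)) ≤ 1 / 8 :=
    (tendsto_rpow_neg_atTop (by positivity)).eventually_le_const (by norm_num)
  obtain ⟨n₀, hn₀⟩ := Filter.eventually_atTop.1 (tendsto_natCast_atTop_atTop.eventually
    (E1.and (E2.and (Filter.eventually_ge_atTop (2 : ℝ)))))
  refine ⟨n₀, fun n hn => ?_⟩
  obtain ⟨h1, h2, h3⟩ := hn₀ n hn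
  have hn0 : (0 : ℝ) < n := by linarith
  have hlog : 0 < Real.log n := Real.log_pos (by linarith)
  have hsq : 1 ≤ √(n : ℝ) := Real.one_le_sqrt.2 (by linarith)
  have hsqpos : 0 < √(n : ℝ) := by linarith
  refine ⟨by exact_mod_cast hn0, ⌈8 * c * n / (s * Real.log n)⌉₊, ?_⟩
  set A := 8 * c * n / (s * Real.log n) with hA
  have hAge : 8 * √n ≤ A := by
    rw [hA, le_div_iff₀ (by positivity)]
    calc 8 * √n * (s * Real.log n) ≤ 8 * √n * (c * √n) := by gcongr
      _ = 8 * c * (√n * √n) := by ring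
      _ = 8 * c * n := by rw [Real.mul_self_sqrt hn0.le]
  have hA0 : 0 < A := by linarith
  refine ⟨Nat.ceil_pos.2 hA0, fun r hr hineq => ?_⟩
  have hM1 : A ≤ (⌈A⌉₊ : ℝ) := Nat.le_ceil A
  have hM2 : (⌈A⌉₊ : ℝ) ≤ 2 * A := by
    have := Nat.ceil_lt_add_one hA0.le
    linarith
  set m : ℝ := (⌈A⌉₊ : ℝ)
  have hm0 : 0 < m := by linarith
  have hVu : c / m ≤ s * Real.log n / (8 * n) := by
    calc c / m ≤ c / A := by gcongr
      _ = _ := by rw [hA]; field_simp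
  have hVl : s * Real.log n / (16 * n) ≤ c / m := by
    calc s * Real.log n / (16 * n) = c / (2 * A) := by rw [hA]; field_simp; norm_num
      _ ≤ _ := by gcongr
  have hKM : √n * (r / m) ≤ r / 8 := by
    rw [mul_div_assoc', div_le_div_iff₀ hm0 (by norm_num)]
    nlinarith [mul_le_mul_of_nonneg_right (hAge.trans hM1) hr]
  have hpow : √n ^ (-l) * (1 + 2 * l / s * (c / m)) ^ n ≤ 1 / 8 := by
    calc √n ^ (-l) * (1 + 2 * l / s * (c / m)) ^ n
        ≤ √n ^ (-l) * (exp (2 * l / s * (s * Real.log n / (8 * n)))) ^ n := by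
          gcongr
          rw [add_comm]
          exact (add_one_le_exp _).trans (by gcongr)
      _ = (n : ℝ) ^ (-(l / 4)) := by
          rw [← exp_nat_mul, Real.sqrt_eq_rpow, ← Real.rpow_mul hn0.le,
            Real.rpow_def_of_pos hn0, Real.rpow_def_of_pos hn0, ← exp_add]
          congr 1
          field_simp
          ring
      _ ≤ 1 / 8 := h2
  have hVpow : c / m * √n ^ (-l) * (1 + 2 * l / s * (c / m)) ^ n ≤ c / m * (1 / 8) := by
    rw [mul_assoc]
    gcongr
  have hfin : 7 / 9 * (c / m) ≤ r := by linarith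
  calc 1 / 25 * s * Real.log n / n = 16 / 25 * (s * Real.log n / (16 * n)) := by
        field_simp
    _ ≤ 7 / 9 * (c / m) := by
        have : 0 ≤ s * Real.log n / (16 * n) := by positivity
        linarith
    _ ≤ r := hfin

/-- **Theorem 2** : minimax lower bound of order `ln n / n` on the class `𝒫_r`,
with Gaussian noise. The threshold `n₀` depends only on `d` and `σ`. -/
theorem minimax_lower_polytopes (d : ℕ) (hd : 2 ≤ d) (σ : ℝ) (hσ : 0 < σ)
    (α : ℝ) (hα : α = 1/2 - Real.log 2 / (2 * Real.log 3)) :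
    ∃ n₀ : ℕ, ∀ r : ℕ, d + 1 ≤ r → ∀ n : ℕ, n₀ ≤ n →
      ∀ hatG : (Fin n → EuclideanSpace ℝ (Fin d) × ℝ) → Set (EuclideanSpace ℝ (Fin d)),
        IsSetEstimator d n hatG →
        ENNReal.ofReal (α^2 * σ^2 * Real.log n / n)
          ≤ ⨆ P ∈ polytopes d r,
              ∫⁻ ω, volume (symmDiff (hatG ω) P)
                ∂ sampleLaw d n (gaussianReal 0 (Real.toNNReal (σ^2))) P := by
  have hs : 0 < σ ^ 2 := by positivity
  have hvpos : 0 < Real.toNNReal (σ ^ 2) := Real.toNNReal_pos.2 hs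
  obtain ⟨c, hc, hsimp⟩ := exists_disjoint_simplices (d := d) (by omega)
  obtain ⟨n₀, hn₀⟩ := exists_card_alternatives hc hs
  refine ⟨n₀, fun r hr n hn hatG hG => ?_⟩
  obtain ⟨hn0, M, hM, hineq⟩ := hn₀ n hn
  obtain ⟨T, hTp, hTd, hTm, hTv⟩ := hsimp M hM
  have hn0' : (0 : ℝ) < n := by exact_mod_cast hn0
  set R := ⨆ P ∈ polytopes d r, ∫⁻ ω, volume (symmDiff (hatG ω) P)
    ∂ sampleLaw d n (gaussianReal 0 (Real.toNNReal (σ^2))) P with hRdef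
  by_cases hRtop : R = ⊤
  · rw [hRtop]; exact le_top
  have hRle : ∀ P ∈ polytopes d r, ∫⁻ ω, volume (symmDiff (hatG ω) P)
      ∂ sampleLaw d n (gaussianReal 0 (Real.toNNReal (σ^2))) P ≤ R := fun P hP =>
    le_iSup₂_of_le P hP le_rfl
  have hmono : polytopes d (d + 1) ⊆ polytopes d r := fun P ⟨W, h1, h2⟩ => ⟨W, h1.trans hr, h2⟩
  have hempty : (∅ : Set (EuclideanSpace ℝ (Fin d))) ∈ polytopes d r :=
    ⟨∅, by simp, by simp, by simp⟩
  have hmain := volume_le_of_risk_le hM hvpos.ne' hG hTm hTd hTv (hRle ∅ hempty)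
    (fun j => hRle _ (hmono (hTp j))) (K := √n) (l := min 1 (σ ^ 2)) (Real.sqrt_pos.2 hn0')
    (le_min zero_le_one hs.le) (min_le_left _ _)
    (by rw [Real.coe_toNNReal _ hs.le]; exact min_le_right _ _)
  have hR' : R = ENNReal.ofReal R.toReal := (ENNReal.ofReal_toReal hRtop).symm
  have hr0 : 0 ≤ R.toReal := ENNReal.toReal_nonneg
  have hM' : (0 : ℝ) < M := by exact_mod_cast hM
  have hl : 0 ≤ min 1 (σ ^ 2) := le_min zero_le_one hs.le
  rw [hR', Real.coe_toNNReal _ hs.le, ← ENNReal.ofReal_natCast M, ← ENNReal.ofReal_div_of_pos hM',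
    ← ENNReal.ofReal_mul (by positivity), ← ENNReal.ofReal_mul (by positivity),
    ← ENNReal.ofReal_mul (by positivity), ← ENNReal.ofReal_one,
    ← ENNReal.ofReal_add (by positivity) (by positivity),
    ← ENNReal.ofReal_add (by positivity) (by positivity),
    ← ENNReal.ofReal_pow (by positivity), ← ENNReal.ofReal_mul (by positivity),
    ← ENNReal.ofReal_add (by positivity) (by positivity),
    ENNReal.ofReal_le_ofReal_iff (by positivity)] at hmain
  rw [hR']
  refine ENNReal.ofReal_le_ofReal (le_trans ?_ (hineq _ hr0 hmain))
  have hα2 : α ^ 2 ≤ 1 / 25 := hα ▸ sq_half_sub_log_ratio_le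
  have hlog : 0 ≤ Real.log n := Real.log_nonneg (by exact_mod_cast hn0)
  gcongr
end
end

section
/- There exists a constant A > 0, independent of the dimension, such that for every integer d ≥ 2, every convex body C ⊆ ℝ^d (compact convex set with nonempty interior), and every integer r ≥ d+1, there exists a polytope C_r with at most r vertices satisfying |C △ C_r| ≤ A d |C| / r^{2/(d−1)}. -/
open MeasureTheory Set Real Pointwise ProbabilityTheory

noncomputable section

section Symmetrization

variable {E : Type*} [NormedAddCommGroup E] [InnerProductSpace ℝ E]

open scoped RealInnerProductSpace

/-- The set of parameters at which the line through `x` in direction `u` meets `A`. -/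
def lineFiber (u : E) (A : Set E) (x : E) : Set ℝ := {t | x + t • u ∈ A}

lemma inner_add_smul_unit {u : E} (hu : ‖u‖ = 1) (x : E) (t : ℝ) :
    ⟪x + t • u, u⟫ = ⟪x, u⟫ + t := by
  rw [inner_add_left, real_inner_smul_left, real_inner_self_eq_norm_sq, hu]; ring

lemma isCompact_lineFiber {u : E} (hu : ‖u‖ = 1) {A : Set E} (hA : IsCompact A) (x : E) :
    IsCompact (lineFiber u A x) := by
  have hc : Continuous fun y : E => ⟪y, u⟫ - ⟪x, u⟫ := by fun_prop
  refine (hA.image hc).of_isClosed_subset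
    (hA.isClosed.preimage (f := fun t : ℝ => x + t • u) (by fun_prop)) ?_
  intro t ht
  exact ⟨x + t • u, ht, by simp only [inner_add_smul_unit hu]; ring⟩

lemma IsCompact.exists_lineFiber_subset_Icc {u : E} (hu : ‖u‖ = 1) {A : Set E}
    (hA : IsCompact A) {x : E} (hne : (lineFiber u A x).Nonempty) :
    ∃ a b : ℝ, x + a • u ∈ A ∧ x + b • u ∈ A ∧ lineFiber u A x ⊆ Icc a b := by
  obtain ⟨a, ha, hamin⟩ := (isCompact_lineFiber hu hA x).exists_isLeast hne
  obtain ⟨b, hb, hbmax⟩ := (isCompact_lineFiber hu hA x).exists_isGreatest hne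
  exact ⟨a, b, ha, hb, fun t ht => ⟨hamin ht, hbmax ht⟩⟩

lemma Convex.ofReal_le_volume_lineFiber {u : E} {A : Set E} (hA : Convex ℝ A) {x : E} {a b : ℝ}
    (ha : x + a • u ∈ A) (hb : x + b • u ∈ A) :
    ENNReal.ofReal (b - a) ≤ volume (lineFiber u A x) := by
  have hc : Convex ℝ (lineFiber u A x) := by
    intro s hs t ht p q hp hq hpq
    have h := hA hs ht hp hq hpq
    have : p • (x + s • u) + q • (x + t • u) = x + (p • s + q • t) • u := by
      have : x = (p + q) • x := by rw [hpq, one_smul]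
      conv_rhs => rw [this]
      simp only [smul_eq_mul]
      module
    rwa [this] at h
  rw [← Real.volume_Icc]
  exact measure_mono (hc.ordConnected.out ha hb)

/-- Pairs of points of `P` and `Q` on a common line in direction `u`, sent to the point of that
line whose signed distance from `uᗮ` is half the signed distance between the two points. -/
def steinerPair (u : E) (P Q : Set E) : Set E :=
  (fun z : E × E => z.1 - ((⟪z.1, u⟫ + ⟪z.2, u⟫) / 2) • u) ''
    ((P ×ˢ Q) ∩ {z | z.1 - ⟪z.1, u⟫ • u = z.2 - ⟪z.2, u⟫ • u})

lemma mem_steinerPair {u : E} {P Q : Set E} {y : E} :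
    y ∈ steinerPair u P Q ↔ ∃ p ∈ P, ∃ q ∈ Q, p - ⟪p, u⟫ • u = q - ⟪q, u⟫ • u ∧
      p - ((⟪p, u⟫ + ⟪q, u⟫) / 2) • u = y := by
  simp only [steinerPair, mem_image, mem_inter_iff, mem_prod, mem_ofPred_eq, Prod.exists]
  constructor
  · rintro ⟨p, q, ⟨⟨hp, hq⟩, h⟩, hy⟩; exact ⟨p, hp, q, hq, h, hy⟩
  · rintro ⟨p, hp, q, hq, h, hy⟩; exact ⟨p, q, ⟨⟨hp, hq⟩, h⟩, hy⟩

lemma isCompact_steinerPair (u : E) {P Q : Set E} (hP : IsCompact P) (hQ : IsCompact Q) :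
    IsCompact (steinerPair u P Q) :=
  ((hP.prod hQ).inter_right (isClosed_eq (by fun_prop) (by fun_prop))).image (by fun_prop)

lemma convex_steinerPair (u : E) {P Q : Set E} (hP : Convex ℝ P) (hQ : Convex ℝ Q) :
    Convex ℝ (steinerPair u P Q) := by
  intro y hy z hz a b ha hb hab
  obtain ⟨p, hp, q, hq, h, rfl⟩ := mem_steinerPair.1 hy
  obtain ⟨p', hp', q', hq', h', rfl⟩ := mem_steinerPair.1 hz
  refine mem_steinerPair.2 ⟨a • p + b • p', hP hp hp' ha hb hab, a • q + b • q',
    hQ hq hq' ha hb hab, ?_, ?_⟩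
  · simp only [inner_add_left, real_inner_smul_left]
    linear_combination (norm := module) a • h + b • h'
  · simp only [inner_add_left, real_inner_smul_left]
    module

lemma steinerPair_self_nonempty {u : E} {K : Set E} (hK : K.Nonempty) :
    (steinerPair u K K).Nonempty := by
  obtain ⟨p, hp⟩ := hK
  exact ⟨_, mem_steinerPair.2 ⟨p, hp, p, hp, rfl, rfl⟩⟩

lemma norm_sq_eq_of_unit {u : E} (hu : ‖u‖ = 1) (x : E) (c : ℝ) :
    ‖x - c • u‖ ^ 2 = ‖x‖ ^ 2 - 2 * c * ⟪x, u⟫ + c ^ 2 := by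
  rw [norm_sub_sq_real, real_inner_smul_right, norm_smul, hu, mul_one, Real.norm_eq_abs, sq_abs]
  ring

lemma steinerPair_norm_sq {u : E} (hu : ‖u‖ = 1) {p q : E}
    (h : p - ⟪p, u⟫ • u = q - ⟪q, u⟫ • u) :
    ‖p - ((⟪p, u⟫ + ⟪q, u⟫) / 2) • u‖ ^ 2 =
      (‖p‖ ^ 2 + ‖q‖ ^ 2) / 2 - ((⟪p, u⟫ + ⟪q, u⟫) / 2) ^ 2 := by
  have h' := congrArg (fun v => ‖v‖ ^ 2) h
  simp only [norm_sq_eq_of_unit hu] at h' ⊢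
  linear_combination (1/2) * h'

lemma steinerPair_subset_closedBall {u : E} (hu : ‖u‖ = 1) {K : Set E} {ρ : ℝ}
    (hK : K ⊆ Metric.closedBall 0 ρ) : steinerPair u K K ⊆ Metric.closedBall 0 ρ := by
  intro y hy
  obtain ⟨p, hp, q, hq, h, rfl⟩ := mem_steinerPair.1 hy
  have hp := mem_closedBall_zero_iff.1 (hK hp)
  have hq := mem_closedBall_zero_iff.1 (hK hq)
  rw [mem_closedBall_zero_iff]
  refine abs_le_of_sq_le_sq' ?_ ((norm_nonneg p).trans hp) |>.2
  rw [steinerPair_norm_sq hu h]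
  nlinarith [norm_nonneg p, norm_nonneg q, sq_nonneg ((⟪p, u⟫ + ⟪q, u⟫) / 2)]

/-- A symmetrized set in a ball touches the sphere only where the original set does, at a point
and at its mirror image. -/
lemma mem_of_mem_steinerPair_sphere {u : E} (hu : ‖u‖ = 1) {K : Set E} {ρ : ℝ}
    (hK : K ⊆ Metric.closedBall 0 ρ) {y : E} (hy : y ∈ steinerPair u K K) (hρ : ‖y‖ = ρ) :
    y ∈ K ∧ y - (2 * ⟪y, u⟫) • u ∈ K := by
  obtain ⟨p, hp, q, hq, h, rfl⟩ := mem_steinerPair.1 hy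
  have hp' := mem_closedBall_zero_iff.1 (hK hp)
  have hq' := mem_closedBall_zero_iff.1 (hK hq)
  have e := steinerPair_norm_sq hu h
  rw [hρ] at e
  have h0 : ⟪p, u⟫ + ⟪q, u⟫ = 0 := by
    have : (⟪p, u⟫ + ⟪q, u⟫) ^ 2 ≤ 0 := by nlinarith [norm_nonneg p, norm_nonneg q]
    exact pow_eq_zero_iff two_ne_zero |>.1 (le_antisymm this (sq_nonneg _))
  simp only [h0, zero_div, zero_smul, sub_zero]
  refine ⟨hp, ?_⟩
  have : p - (2 * ⟪p, u⟫) • u = q := by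
    have : ⟪q, u⟫ = -⟪p, u⟫ := by linarith
    rw [this] at h
    linear_combination (norm := module) h
  rwa [this]

open TopologicalSpace

lemma isClosed_setOf_convex : IsClosed {K : NonemptyCompacts E | Convex ℝ (K : Set E)} := by
  rw [← isOpen_compl_iff, isOpen_iff_mem_nhds]
  intro K hK
  simp only [mem_compl_iff, mem_ofPred_eq, Convex, StarConvex] at hK
  push Not at hK
  obtain ⟨x, hx, y, hy, a, b, ha, hb, hab, hz⟩ := hK
  obtain ⟨W, Z, hW, hZ, hKW, hzZ, hWZ⟩ :=
    K.isCompact.separation_of_notMem hz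
  have hcont : Continuous fun w : E × E => a • w.1 + b • w.2 := by fun_prop
  obtain ⟨X, Y, hX, hY, hxX, hyY, hXY⟩ :=
    isOpen_prod_iff.1 (hZ.preimage hcont) x y hzZ
  have hO := ((NonemptyCompacts.isOpen_subsets_of_isOpen hW).inter
    ((NonemptyCompacts.isOpen_inter_nonempty_of_isOpen hX).inter
    (NonemptyCompacts.isOpen_inter_nonempty_of_isOpen hY)))
  refine Filter.mem_of_superset (hO.mem_nhds ⟨hKW, ⟨x, hx, hxX⟩, ⟨y, hy, hyY⟩⟩) ?_
  rintro L ⟨hLW, ⟨x', hx', hx'X⟩, ⟨y', hy', hy'Y⟩⟩ hL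
  exact disjoint_left.1 hWZ (hLW (hL hx' hy' ha hb hab)) (hXY (mk_mem_prod hx'X hy'Y))

variable [FiniteDimensional ℝ E]

lemma mem_convexHull_range_of_closedBall_subset {ι : Type*} [Finite ι] {p q : ι → E} {x : E}
    {δ : ℝ} (hδ : 0 ≤ δ) (hx : Metric.closedBall x δ ⊆ convexHull ℝ (range p))
    (hpq : ∀ i, dist (p i) (q i) ≤ δ) : x ∈ convexHull ℝ (range q) := by
  by_contra hxq
  obtain ⟨f, s, hf, hs⟩ := geometric_hahn_banach_closed_point (convex_convexHull ℝ (range q))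
    ((finite_range q).isCompact_convexHull (𝕜 := ℝ)).isClosed hxq
  set v : E := (InnerProductSpace.toDual ℝ E).symm f with hv
  have hfv : ∀ y, f y = ⟪v, y⟫ := fun y => by simp [hv]
  have hsub : convexHull ℝ (range p) ⊆ {y | f y ≤ s + ‖v‖ * δ} := by
    refine convexHull_min ?_ (convex_halfSpace_le f.toLinearMap.isLinear _)
    rintro _ ⟨i, rfl⟩
    have h1 := hf (q i) (subset_convexHull ℝ _ (mem_range_self i))
    have h2 : f (p i) - f (q i) ≤ ‖v‖ * δ := by
      rw [← map_sub, hfv]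
      refine (real_inner_le_norm _ _).trans ?_
      gcongr
      rw [← dist_eq_norm]; exact hpq i
    change f (p i) ≤ _
    linarith
  have hmem : x + (δ / ‖v‖) • v ∈ Metric.closedBall x δ := by
    rw [mem_closedBall_iff_norm, add_sub_cancel_left, norm_smul, Real.norm_eq_abs,
      abs_of_nonneg (by positivity)]
    rcases eq_or_ne ‖v‖ 0 with h | h
    · simpa [h] using hδ
    · rw [div_mul_cancel₀ _ h]
  have h3 : f (x + (δ / ‖v‖) • v) ≤ s + ‖v‖ * δ := hsub (hx hmem)
  have h4 : f (x + (δ / ‖v‖) • v) = f x + ‖v‖ * δ := by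
    rw [map_add, map_smul, hfv v, real_inner_self_eq_norm_sq, smul_eq_mul]
    rcases eq_or_ne ‖v‖ 0 with h | h
    · simp [h]
    · field_simp
  linarith

lemma closedBall_subset_convexHull_of_net [Nontrivial E] {s : Set E} (hfin : s.Finite) {ε : ℝ}
    (hs : ∀ x ∈ s, ‖x‖ = 1) (hnet : ∀ v : E, ‖v‖ = 1 → ∃ x ∈ s, dist v x ≤ ε) :
    Metric.closedBall 0 (1 - ε ^ 2 / 2) ⊆ convexHull ℝ s := by
  intro y hy
  by_contra hys
  obtain ⟨f, t, hf, ht⟩ := geometric_hahn_banach_closed_point (convex_convexHull ℝ s)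
    (hfin.isCompact_convexHull (𝕜 := ℝ)).isClosed hys
  set v : E := (InnerProductSpace.toDual ℝ E).symm f with hv
  have hfv : ∀ y, f y = ⟪v, y⟫ := fun y => by simp [hv]
  have hfs : ∀ x ∈ s, ⟪v, x⟫ < ⟪v, y⟫ := fun x hx => by
    rw [← hfv, ← hfv]
    exact (hf x (subset_convexHull ℝ s hx)).trans ht
  have hv0 : v ≠ 0 := by
    intro h0
    obtain ⟨e, he⟩ := exists_norm_eq E (zero_le_one (α := ℝ))
    obtain ⟨x, hx, -⟩ := hnet e he
    simpa [h0] using hfs x hx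
  have hvn : ‖v‖ ≠ 0 := norm_ne_zero_iff.2 hv0
  obtain ⟨x, hx, hxd⟩ := hnet (‖v‖⁻¹ • v)
    (by rw [norm_smul, norm_inv, norm_norm, inv_mul_cancel₀ hvn])
  have h1 : dist (‖v‖⁻¹ • v) x ^ 2 ≤ ε ^ 2 := pow_le_pow_left₀ dist_nonneg hxd 2
  rw [dist_eq_norm, norm_sub_sq_real, norm_smul, norm_inv, norm_norm, inv_mul_cancel₀ hvn, hs x hx,
    real_inner_smul_left] at h1
  have h2 : 1 - ε ^ 2 / 2 ≤ ‖v‖⁻¹ * ⟪v, x⟫ := by linarith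
  have h3 : ‖v‖ * (1 - ε ^ 2 / 2) ≤ ⟪v, x⟫ := by
    calc _ ≤ ‖v‖ * (‖v‖⁻¹ * ⟪v, x⟫) := by gcongr
      _ = _ := by field_simp
  have h4 : ⟪v, y⟫ ≤ ‖v‖ * (1 - ε ^ 2 / 2) :=
    (real_inner_le_norm v y).trans (by gcongr; exact mem_closedBall_zero_iff.1 hy)
  linarith [hfs x hx]

variable [MeasurableSpace E] [BorelSpace E]

lemma measure_eq_lintegral_lineFiber (μ : Measure E) [μ.IsAddHaarMeasure] {u : E} (hu : ‖u‖ = 1)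
    {A : Set E} (hA : MeasurableSet A) :
    μ A = ∫⁻ x in {x | ⟪x, u⟫ ∈ Icc (0 : ℝ) 1}, volume (lineFiber u A x) ∂μ := by
  set W : Set E := {x | ⟪x, u⟫ ∈ Icc (0 : ℝ) 1} with hW
  have hWm : MeasurableSet W :=
    measurableSet_Icc.preimage (f := fun x : E => ⟪x, u⟫) (by fun_prop)
  let f : E → ENNReal := W.indicator 1
  let g : E → ENNReal := A.indicator 1
  have hf : Measurable f := measurable_one.indicator hWm
  have hg : Measurable g := measurable_one.indicator hA
  have h1 : ∀ x, ∫⁻ t : ℝ, f (x - t • u) * g x = g x := by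
    intro x
    rw [lintegral_mul_const _ (by fun_prop)]
    have : (fun t : ℝ => f (x - t • u)) = (Icc (⟪x, u⟫ - 1) ⟪x, u⟫).indicator 1 := by
      funext t
      have : x - t • u ∈ W ↔ t ∈ Icc (⟪x, u⟫ - 1) ⟪x, u⟫ := by
        rw [sub_eq_add_neg, ← neg_smul, hW, mem_ofPred_eq, inner_add_smul_unit hu, mem_Icc, mem_Icc]
        constructor <;> rintro ⟨h, h'⟩ <;> constructor <;> linarith
      by_cases ht : t ∈ Icc (⟪x, u⟫ - 1) ⟪x, u⟫
      · simp only [f, indicator_of_mem ht, indicator_of_mem (this.2 ht)]; rfl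
      · simp only [f, indicator_of_notMem ht, indicator_of_notMem (fun h => ht (this.1 h))]
    rw [this, lintegral_indicator_one measurableSet_Icc]
    simp
  have h2 : ∀ x, ∫⁻ t : ℝ, f x * g (x + t • u) = f x * volume (lineFiber u A x) := by
    intro x
    rw [lintegral_const_mul _ (by fun_prop)]
    congr 1
    have : MeasurableSet (lineFiber u A x) :=
      hA.preimage (f := fun t : ℝ => x + t • u) (by fun_prop)
    rw [← lintegral_indicator_one this]
    rfl
  calc μ A = ∫⁻ x, g x ∂μ := (lintegral_indicator_one hA).symm
    _ = ∫⁻ x, (∫⁻ t : ℝ, f (x - t • u) * g x) ∂μ := by simp_rw [h1]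
    _ = ∫⁻ t : ℝ, ∫⁻ x, f (x - t • u) * g x ∂μ :=
      lintegral_lintegral_swap (by unfold Function.uncurry; fun_prop)
    _ = ∫⁻ t : ℝ, ∫⁻ x, f x * g (x + t • u) ∂μ := by
      refine lintegral_congr fun t => ?_
      rw [← lintegral_add_right_eq_self _ (t • u)]
      simp
    _ = ∫⁻ x, (∫⁻ t : ℝ, f x * g (x + t • u)) ∂μ :=
      lintegral_lintegral_swap (by unfold Function.uncurry; fun_prop)
    _ = ∫⁻ x, f x * volume (lineFiber u A x) ∂μ := by simp_rw [h2]
    _ = _ := by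
      rw [← lintegral_indicator hWm]
      refine lintegral_congr fun x => ?_
      by_cases hx : x ∈ W <;> simp [f, hx]

lemma measurable_volume_lineFiber (u : E) {A : Set E} (hA : MeasurableSet A) :
    Measurable fun x => volume (lineFiber u A x) := by
  have : MeasurableSet {p : E × ℝ | p.1 + p.2 • u ∈ A} :=
    hA.preimage (f := fun p : E × ℝ => p.1 + p.2 • u) (by fun_prop)
  exact measurable_measure_prodMk_left this

lemma two_mul_measure_le_of_lineFiber (μ : Measure E) [μ.IsAddHaarMeasure] {u : E}
    (hu : ‖u‖ = 1) {Y A B : Set E} (hY : MeasurableSet Y) (hA : MeasurableSet A)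
    (hB : MeasurableSet B)
    (h : ∀ x, 2 * volume (lineFiber u Y x) ≤ volume (lineFiber u A x) + volume (lineFiber u B x)) :
    2 * μ Y ≤ μ A + μ B := by
  rw [measure_eq_lintegral_lineFiber μ hu hY, measure_eq_lintegral_lineFiber μ hu hA,
    measure_eq_lintegral_lineFiber μ hu hB,
    ← lintegral_const_mul _ (measurable_volume_lineFiber u hY),
    ← lintegral_add_left (measurable_volume_lineFiber u hA)]
  exact lintegral_mono h

/-- If the lines of `Y` are averages of lines of `P` and `Q`, so is its volume. -/
lemma two_mul_measure_le_of_subset_steinerPair (μ : Measure E) [μ.IsAddHaarMeasure] {u : E}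
    (hu : ‖u‖ = 1) {Y P Q : Set E} (hY : IsCompact Y) (hP : IsCompact P) (hQ : IsCompact Q)
    (hPc : Convex ℝ P) (hQc : Convex ℝ Q) (h : Y ⊆ steinerPair u P Q) :
    2 * μ Y ≤ μ P + μ Q := by
  refine two_mul_measure_le_of_lineFiber μ hu hY.measurableSet hP.measurableSet hQ.measurableSet
    fun x => ?_
  rcases (lineFiber u Y x).eq_empty_or_nonempty with he | hne
  · simp [he]
  obtain ⟨a, b, ha, hb, hab⟩ := hY.exists_lineFiber_subset_Icc hu hne
  obtain ⟨p, hp, q, hq, e, e'⟩ := mem_steinerPair.1 (h ha)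
  obtain ⟨p', hp', q', hq', f, f'⟩ := mem_steinerPair.1 (h hb)
  have huu : ⟪u, u⟫ = 1 := by rw [real_inner_self_eq_norm_sq, hu]; norm_num
  have i1 := congrArg (fun v => ⟪v, u⟫) e'
  have i2 := congrArg (fun v => ⟪v, u⟫) f'
  simp only [inner_sub_left, inner_add_left, real_inner_smul_left, huu] at i1 i2
  have on_line : ∀ {v w : E} {c : ℝ}, v - ⟪v, u⟫ • u = w - ⟪w, u⟫ • u → w = x + c • u →
      v = x + (⟪v, u⟫ - ⟪x, u⟫) • u := by
    intro v w c hvw hw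
    have : w - ⟪w, u⟫ • u = x - ⟪x, u⟫ • u := by
      rw [hw, inner_add_smul_unit hu]; module
    rw [this] at hvw
    linear_combination (norm := module) hvw
  have pe : p - ⟪p, u⟫ • u = (x + a • u) - ⟪x + a • u, u⟫ • u := by
    rw [← e']
    simp only [inner_sub_left, real_inner_smul_left, huu]
    module
  have pf : p' - ⟪p', u⟫ • u = (x + b • u) - ⟪x + b • u, u⟫ • u := by
    rw [← f']
    simp only [inner_sub_left, real_inner_smul_left, huu]
    module
  have lp := hPc.ofReal_le_volume_lineFiber (x := x) (u := u)
    (on_line pe rfl ▸ hp) (on_line pf rfl ▸ hp')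
  have lq := hQc.ofReal_le_volume_lineFiber (x := x) (u := u)
    (on_line (f.symm.trans pf) rfl ▸ hq') (on_line (e.symm.trans pe) rfl ▸ hq)
  calc 2 * volume (lineFiber u Y x) ≤ 2 * ENNReal.ofReal (b - a) := by
        gcongr
        exact (measure_mono hab).trans_eq Real.volume_Icc
    _ = ENNReal.ofReal (2 * (b - a)) := by
        rw [ENNReal.ofReal_mul (by norm_num)]; norm_num
    _ = ENNReal.ofReal (((⟪p', u⟫ - ⟪x, u⟫) - (⟪p, u⟫ - ⟪x, u⟫))
          + ((⟪q, u⟫ - ⟪x, u⟫) - (⟪q', u⟫ - ⟪x, u⟫))) := by congr 1; linarith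
    _ ≤ _ := ENNReal.ofReal_add_le.trans (add_le_add lp lq)

lemma measure_le_measure_steinerPair_self (μ : Measure E) [μ.IsAddHaarMeasure] {u : E}
    (hu : ‖u‖ = 1) {K : Set E} (hK : IsCompact K) (hKc : Convex ℝ K) :
    μ K ≤ μ (steinerPair u K K) := by
  have hS := isCompact_steinerPair u hK hK
  have huu : ⟪u, u⟫ = 1 := by rw [real_inner_self_eq_norm_sq, hu]; norm_num
  rw [measure_eq_lintegral_lineFiber μ hu hK.measurableSet,
    measure_eq_lintegral_lineFiber μ hu hS.measurableSet]
  refine lintegral_mono fun x => ?_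
  rcases (lineFiber u K x).eq_empty_or_nonempty with he | hne
  · simp [he]
  obtain ⟨a, b, ha, hb, hab⟩ := hK.exists_lineFiber_subset_Icc hu hne
  have key : ∀ {s t : ℝ}, x + s • u ∈ K → x + t • u ∈ K →
      x + ((s - t) / 2 - ⟪x, u⟫) • u ∈ steinerPair u K K := by
    intro s t hs ht
    refine mem_steinerPair.2 ⟨_, hs, _, ht, ?_, ?_⟩
    · simp only [inner_add_smul_unit hu]; module
    · simp only [inner_add_smul_unit hu]; module
  calc volume (lineFiber u K x) ≤ ENNReal.ofReal (b - a) :=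
        (measure_mono hab).trans_eq Real.volume_Icc
    _ = ENNReal.ofReal (((b - a) / 2 - ⟪x, u⟫) - ((a - b) / 2 - ⟪x, u⟫)) := by congr 1; ring
    _ ≤ _ := (convex_steinerPair u hKc hKc).ofReal_le_volume_lineFiber (key ha hb) (key hb ha)

/-- The volume of a polytope is a lower semicontinuous function of its vertices. -/
lemma exists_forall_lt_measure_convexHull (μ : Measure E) [μ.IsAddHaarMeasure] {ι : Type*}
    [Finite ι] {p : ι → E} {m : ENNReal} (h : m < μ (convexHull ℝ (range p))) :
    ∃ δ > 0, ∀ q : ι → E, (∀ i, dist (p i) (q i) ≤ δ) → m < μ (convexHull ℝ (range q)) := by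
  have hc := convex_convexHull ℝ (range p)
  have hint : m < μ (interior (convexHull ℝ (range p))) := by
    rwa [measure_congr (interior_ae_eq_of_null_frontier (hc.addHaar_frontier μ))]
  obtain ⟨F, hF, hFc, hmF⟩ := isOpen_interior.exists_lt_isCompact hint
  obtain ⟨δ, hδ, hsub⟩ := hFc.exists_cthickening_subset_open isOpen_interior hF
  refine ⟨δ, hδ, fun q hq => hmF.trans_le (measure_mono fun x hx => ?_)⟩
  exact mem_convexHull_range_of_closedBall_subset hδ.le
    ((Metric.closedBall_subset_cthickening hx δ).trans (hsub.trans interior_subset)) hq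

/-- Convex sets of volume at least `V` all of whose inscribed polytopes with vertices indexed by
`ι` have volume at most `m`. -/
structure PolytopeBounded (μ : Measure E) (ι : Type*) (V m : ENNReal) (K : Set E) : Prop where
  convex : Convex ℝ K
  le_measure : V ≤ μ K
  hull_le : ∀ p : ι → E, (∀ i, p i ∈ K) → μ (convexHull ℝ (range p)) ≤ m

lemma isClosed_setOf_polytopeBounded (μ : Measure E) [μ.IsAddHaarMeasure] {ι : Type*} [Finite ι]
    (V m : ENNReal) :
    IsClosed {K : NonemptyCompacts E | PolytopeBounded μ ι V m (K : Set E)} := by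
  have hvol : IsClosed {K : NonemptyCompacts E | V ≤ μ K} := by
    rw [← isOpen_compl_iff, isOpen_iff_mem_nhds]
    intro K hK
    obtain ⟨U, hKU, hU, hUV⟩ := (K : Set E).exists_isOpen_lt_of_lt V (not_le.1 hK)
    refine Filter.mem_of_superset
      ((NonemptyCompacts.isOpen_subsets_of_isOpen hU).mem_nhds hKU) fun L hL => ?_
    exact not_le.2 ((measure_mono hL).trans_lt hUV)
  have hhull : IsClosed {K : NonemptyCompacts E |
      ∀ p : ι → E, (∀ i, p i ∈ K) → μ (convexHull ℝ (range p)) ≤ m} := by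
    rw [← isOpen_compl_iff, isOpen_iff_mem_nhds]
    intro K hK
    simp only [mem_compl_iff, mem_ofPred_eq] at hK
    push Not at hK
    obtain ⟨p, hp, hpm⟩ := hK
    obtain ⟨δ, hδ, hq⟩ := exists_forall_lt_measure_convexHull μ hpm
    have hO : IsOpen (⋂ i,
        {L : NonemptyCompacts E | ((L : Set E) ∩ Metric.ball (p i) δ).Nonempty}) :=
      isOpen_iInter_of_finite fun i =>
        NonemptyCompacts.isOpen_inter_nonempty_of_isOpen Metric.isOpen_ball
    refine Filter.mem_of_superset (hO.mem_nhds
      (mem_iInter.2 fun i => ⟨p i, hp i, Metric.mem_ball_self hδ⟩)) fun L hL hL' => ?_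
    choose q hqL hqp using mem_iInter.1 hL
    refine (hq q fun i => ?_).not_ge (hL' q hqL)
    rw [dist_comm]; exact (hqp i).le
  convert (isClosed_setOf_convex (E := E)).inter (hvol.inter hhull) using 1
  ext K
  exact ⟨fun h => ⟨h.1, h.2, h.3⟩, fun h => ⟨h.1, h.2.1, h.2.2⟩⟩

lemma PolytopeBounded.steinerPair {μ : Measure E} [μ.IsAddHaarMeasure] {ι : Type*} [Finite ι]
    {V m : ENNReal} {K : Set E} (h : PolytopeBounded μ ι V m K) (hK : IsCompact K) {u : E}
    (hu : ‖u‖ = 1) : PolytopeBounded μ ι V m (steinerPair u K K) where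
  convex := convex_steinerPair u h.convex h.convex
  le_measure := h.le_measure.trans (measure_le_measure_steinerPair_self μ hu hK h.convex)
  hull_le y hy := by
    choose p hp q hq hpq e using fun i => mem_steinerPair.1 (hy i)
    have hsub : convexHull ℝ (range y) ⊆
        _root_.steinerPair u (convexHull ℝ (range p)) (convexHull ℝ (range q)) := by
      refine convexHull_min ?_
        (convex_steinerPair u (convex_convexHull ℝ _) (convex_convexHull ℝ _))
      rintro _ ⟨i, rfl⟩
      exact mem_steinerPair.2 ⟨p i, subset_convexHull ℝ _ (mem_range_self i), q i,
        subset_convexHull ℝ _ (mem_range_self i), hpq i, e i⟩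
    have h2 := two_mul_measure_le_of_subset_steinerPair μ hu
      ((finite_range y).isCompact_convexHull (𝕜 := ℝ))
      ((finite_range p).isCompact_convexHull (𝕜 := ℝ))
      ((finite_range q).isCompact_convexHull (𝕜 := ℝ)) (convex_convexHull ℝ _)
      (convex_convexHull ℝ _) hsub
    have h3 := h2.trans (add_le_add (h.hull_le p hp) (h.hull_le q hq))
    rw [← two_mul] at h3
    exact (ENNReal.mul_le_mul_iff_right (by norm_num) (by norm_num)).1 h3

/-- Finitely many symmetrizations detach a set from the sphere it is inscribed in, unless it
contains the whole sphere. -/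
lemma PolytopeBounded.exists_disjoint_sphere {μ : Measure E} [μ.IsAddHaarMeasure] {ι : Type*}
    [Finite ι] {V m : ENNReal} {K : NonemptyCompacts E} (h : PolytopeBounded μ ι V m (K : Set E))
    {ρ : ℝ} (hK : (K : Set E) ⊆ Metric.closedBall 0 ρ) {x : E} (hx : ‖x‖ = ρ) (hxK : x ∉ K) :
    ∃ L : NonemptyCompacts E, PolytopeBounded μ ι V m (L : Set E) ∧
      (L : Set E) ⊆ Metric.ball 0 ρ := by
  have step : ∀ T : Finset {u : E // ‖u‖ = 1}, ∃ L : NonemptyCompacts E,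
      PolytopeBounded μ ι V m (L : Set E) ∧ (L : Set E) ⊆ Metric.closedBall 0 ρ ∧
      ∀ y ∈ L, ‖y‖ = ρ → y ∈ K ∧ ∀ u ∈ T, y - (2 * ⟪y, (u : E)⟫) • (u : E) ∈ K := by
    classical
    intro T
    induction T using Finset.induction_on with
    | empty => exact ⟨K, h, hK, fun y hy _ => ⟨hy, by simp⟩⟩
    | insert u T _ ih =>
      obtain ⟨L, hL, hLρ, hLK⟩ := ih
      refine ⟨⟨⟨_root_.steinerPair (u : E) L L, isCompact_steinerPair _ L.isCompact L.isCompact⟩,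
        steinerPair_self_nonempty L.nonempty⟩, hL.steinerPair L.isCompact u.2,
        steinerPair_subset_closedBall u.2 hLρ, fun y hy hyρ => ?_⟩
      obtain ⟨h1, h2⟩ := mem_of_mem_steinerPair_sphere u.2 hLρ hy hyρ
      have h3 : ‖y - (2 * ⟪y, (u : E)⟫) • (u : E)‖ = ρ := by
        rw [← sq_eq_sq₀ (norm_nonneg _) (hyρ ▸ norm_nonneg y), norm_sq_eq_of_unit u.2, hyρ]
        ring
      refine ⟨(hLK y h1 hyρ).1, fun w hw => ?_⟩
      rcases Finset.mem_insert.1 hw with rfl | hw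
      · exact (hLK _ h2 h3).1
      · exact (hLK y h1 hyρ).2 w hw
  have hcomp : IsCompact ((K : Set E) ∩ {y | ‖y‖ = ρ}) :=
    K.isCompact.inter_right (isClosed_eq continuous_norm continuous_const)
  obtain ⟨T, hT⟩ := hcomp.elim_finite_subcover
    (fun u : {u : E // ‖u‖ = 1} => {y | y - (2 * ⟪y, (u : E)⟫) • (u : E) ∉ K})
    (fun u => K.isCompact.isClosed.isOpen_compl.preimage
      (f := fun y : E => y - (2 * ⟪y, (u : E)⟫) • (u : E)) (by fun_prop)) (by
      rintro z ⟨hz, hzρ⟩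
      have hzx : ‖z - x‖ ≠ 0 := by
        rw [norm_ne_zero_iff, sub_ne_zero]
        rintro rfl
        exact hxK hz
      have hzρ : ‖z‖ = ρ := hzρ
      refine mem_iUnion.2 ⟨⟨‖z - x‖⁻¹ • (z - x), ?_⟩, ?_⟩
      · rw [norm_smul, norm_inv, norm_norm, inv_mul_cancel₀ hzx]
      · have h1 : 2 * ⟪z, z - x⟫ = ‖z - x‖ ^ 2 := by
          rw [norm_sub_sq_real, inner_sub_right, real_inner_self_eq_norm_sq, hzρ, hx]; ring
        have h2 : z - (2 * ⟪z, ‖z - x‖⁻¹ • (z - x)⟫) • ‖z - x‖⁻¹ • (z - x) = x := by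
          rw [real_inner_smul_right, smul_smul]
          have : 2 * (‖z - x‖⁻¹ * ⟪z, z - x⟫) * ‖z - x‖⁻¹ = 1 := by
            field_simp
            linarith
          rw [this]; module
        simpa only [mem_ofPred_eq, h2] using hxK)
  obtain ⟨L, hL, hLρ, hLK⟩ := step T
  refine ⟨L, hL, fun y hy => ?_⟩
  rw [mem_ball_zero_iff]
  refine lt_of_le_of_ne (mem_closedBall_zero_iff.1 (hLρ hy)) fun hyρ => ?_
  obtain ⟨h1, h2⟩ := hLK y hy hyρ
  obtain ⟨u, hu, hyu⟩ := mem_iUnion₂.1 (hT ⟨h1, hyρ⟩)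
  exact hyu (h2 u hu)

/-- **Macbeath's theorem**: among convex bodies of given volume, balls are the worst approximated
by inscribed polytopes. -/
theorem PolytopeBounded.exists_closedBall [Nontrivial E] {μ : Measure E} [μ.IsAddHaarMeasure]
    {ι : Type*} [Finite ι] {V m : ENNReal} {C : Set E} (h : PolytopeBounded μ ι V m C)
    (hC : IsCompact C) (hne : C.Nonempty) :
    ∃ ρ : ℝ, 0 ≤ ρ ∧ PolytopeBounded μ ι V m (Metric.closedBall (0 : E) ρ) := by
  let rad : NonemptyCompacts E → ENNReal := fun K => ⨆ x ∈ K, ‖x‖ₑ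
  have rad_le : ∀ (K : NonemptyCompacts E) (c : ENNReal),
      rad K ≤ c ↔ (K : Set E) ⊆ {x | ‖x‖ₑ ≤ c} := fun K c => iSup₂_le_iff
  have hlsc : LowerSemicontinuous rad := by
    rw [lowerSemicontinuous_iff_isClosed_preimage]
    intro c
    have : rad ⁻¹' Iic c = {K : NonemptyCompacts E | (K : Set E) ⊆ {x | ‖x‖ₑ ≤ c}} := by
      ext K; exact rad_le K c
    rw [this]
    exact NonemptyCompacts.isClosed_subsets_of_isClosed
      (isClosed_le continuous_enorm continuous_const)
  obtain ⟨R, hR⟩ := hC.isBounded.subset_closedBall 0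
  let S : Set (NonemptyCompacts E) :=
    {K : NonemptyCompacts E | (K : Set E) ⊆ Metric.closedBall 0 R} ∩
      {K : NonemptyCompacts E | PolytopeBounded μ ι V m (K : Set E)}
  have hS : IsCompact S :=
    (NonemptyCompacts.isCompact_subsets_of_isCompact (isCompact_closedBall 0 R)).inter_right
      (isClosed_setOf_polytopeBounded μ V m)
  obtain ⟨K, ⟨hKR, hK⟩, hmin⟩ := (hlsc.lowerSemicontinuousOn S).exists_isMinOn
    (⟨⟨⟨C, hC⟩, hne⟩, hR, h⟩ : S.Nonempty) hS
  obtain ⟨w, hwK, hw⟩ := K.isCompact.exists_isMaxOn K.nonempty continuous_norm.continuousOn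
  have hKρ : (K : Set E) ⊆ Metric.closedBall 0 ‖w‖ := fun x hx =>
    mem_closedBall_zero_iff.2 (hw hx)
  refine ⟨‖w‖, norm_nonneg w, ?_⟩
  suffices hball : Metric.closedBall 0 ‖w‖ ⊆ (K : Set E) by
    rwa [hball.antisymm hKρ]
  rw [← convexHull_sphere_eq_closedBall _ (norm_nonneg w)]
  refine convexHull_min (fun x hx => ?_) hK.convex
  by_contra hxK
  obtain ⟨L, hL, hLρ⟩ := hK.exists_disjoint_sphere hKρ (mem_sphere_zero_iff_norm.1 hx) hxK
  obtain ⟨v, hvL, hv⟩ := L.isCompact.exists_isMaxOn L.nonempty continuous_norm.continuousOn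
  have hLR : (L : Set E) ⊆ Metric.closedBall 0 R := fun y hy => by
    rw [mem_closedBall_zero_iff]
    exact (mem_ball_zero_iff.1 (hLρ hy)).le.trans (mem_closedBall_zero_iff.1 (hKR hwK))
  have h1 : rad K ≤ rad L := hmin ⟨hLR, hL⟩
  have h2 : ‖w‖ₑ ≤ ‖v‖ₑ := by
    refine ((le_iSup₂ (f := fun x (_ : x ∈ K) => ‖x‖ₑ) w hwK).trans h1).trans ?_
    exact (rad_le L _).2 fun y hy => enorm_le_iff_norm_le.2 (hv hy)
  exact (enorm_le_iff_norm_le.1 h2).not_gt (mem_ball_zero_iff.1 (hLρ hvL))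

lemma card_le_of_pairwise_lt_dist {s : Finset E} (hd : 2 ≤ Module.finrank ℝ E) {ε : ℝ}
    (hε : 0 < ε) (hε1 : ε ≤ 1) (hs : ∀ x ∈ s, ‖x‖ = 1)
    (hsep : ∀ x ∈ s, ∀ y ∈ s, x ≠ y → ε < dist x y) :
    (s.card : ℝ) ≤ 2 * Module.finrank ℝ E * (2 / ε + 1) ^ (Module.finrank ℝ E - 1) := by
  have : Nontrivial E := Module.nontrivial_of_finrank_pos (R := ℝ) (by omega)
  obtain ⟨n, hn⟩ : ∃ n, Module.finrank ℝ E = n + 1 := ⟨Module.finrank ℝ E - 1, by omega⟩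
  let μ : Measure E := Measure.addHaar
  set B := μ.real (Metric.ball (0 : E) 1) with hB
  have hBpos : 0 < B :=
    ENNReal.toReal_pos (Metric.measure_ball_pos μ 0 one_pos).ne' measure_ball_lt_top.ne
  have hball : ∀ (x : E) {t : ℝ}, 0 ≤ t → μ.real (Metric.ball x t) = t ^ (n + 1) * B := by
    intro x t ht
    rw [← μ.addHaar_real_closedBall_eq_addHaar_real_ball, μ.addHaar_real_closedBall x ht, hn]
  have hunion : μ.real (⋃ x ∈ s, Metric.ball x (ε / 2)) = s.card * ((ε / 2) ^ (n + 1) * B) := by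
    rw [measureReal_biUnion_finset]
    · simp [hball _ (half_pos hε).le]
    · intro x hx y hy hxy
      exact Metric.ball_disjoint_ball (by linarith [hsep x hx y hy hxy])
    · exact fun x _ => measurableSet_ball
  have hsub : (⋃ x ∈ s, Metric.ball x (ε / 2)) ⊆
      Metric.ball 0 (1 + ε / 2) \ Metric.ball 0 (1 - ε / 2) := by
    refine iUnion₂_subset fun x hx y hy => ?_
    rw [mem_ball_iff_norm] at hy
    have h1 := norm_sub_norm_le y x
    have h2 := norm_sub_norm_le x y
    rw [norm_sub_rev] at h2
    rw [hs x hx] at h1 h2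
    simp only [mem_sdiff, mem_ball_zero_iff, not_lt]
    constructor <;> linarith
  have hle := measureReal_mono (μ := μ) hsub
    (measure_ball_lt_top.trans_le' (measure_mono sdiff_subset)).ne
  rw [measureReal_sdiff (Metric.ball_subset_ball (by linarith)) measurableSet_ball,
    hunion, hball 0 (by linarith), hball 0 (by linarith)] at hle
  have hle' : s.card * (ε / 2) ^ (n + 1) ≤ (1 + ε / 2) ^ (n + 1) - (1 - ε / 2) ^ (n + 1) := by
    refine le_of_mul_le_mul_right ?_ hBpos
    linarith
  set b := 1 + ε / 2 with hb
  have hbpos : 0 < b := by positivity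
  have hbern : b ^ (n + 1) - (1 - ε / 2) ^ (n + 1) ≤ (n + 1) * ε * b ^ n := by
    have h := one_add_mul_le_pow (a := (1 - ε / 2) / b - 1)
      (by have : 0 ≤ (1 - ε / 2) / b := div_nonneg (by linarith) hbpos.le
          linarith) (n + 1)
    rw [add_sub_cancel, div_pow] at h
    have h' := mul_le_mul_of_nonneg_right h (pow_pos hbpos (n + 1)).le
    rw [div_mul_cancel₀ _ (by positivity)] at h'
    have : (1 + ((n + 1 : ℕ) : ℝ) * ((1 - ε / 2) / b - 1)) * b ^ (n + 1)
        = b ^ (n + 1) - (n + 1) * ε * b ^ n := by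
      push_cast
      rw [pow_succ]
      field_simp
      rw [hb]
      ring
    linarith
  rw [hn, Nat.add_sub_cancel]
  have hpos : 0 < (ε / 2) ^ (n + 1) := by positivity
  refine le_of_mul_le_mul_right ((hle'.trans hbern).trans_eq ?_) hpos
  have : b = (2 / ε + 1) * (ε / 2) := by rw [hb]; field_simp
  rw [this, mul_pow, pow_succ (ε / 2)]
  push_cast
  ring

lemma exists_finset_sphere_net (hd : 2 ≤ Module.finrank ℝ E) {ε : ℝ} (hε : 0 < ε) (hε1 : ε ≤ 1)
    {r : ℕ} (hr : 2 * Module.finrank ℝ E * (2 / ε + 1) ^ (Module.finrank ℝ E - 1) ≤ (r : ℝ)) :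
    ∃ s : Finset E, s.card ≤ r ∧ (∀ x ∈ s, ‖x‖ = 1) ∧
      ∀ v : E, ‖v‖ = 1 → ∃ x ∈ s, dist v x ≤ ε := by
  classical
  let p : ℕ → Prop := fun n => ∃ s : Finset E, s.card = n ∧ (∀ x ∈ s, ‖x‖ = 1) ∧
    ∀ x ∈ s, ∀ y ∈ s, x ≠ y → ε < dist x y
  have hp : ∀ n, p n → n ≤ r := by
    rintro _ ⟨s, rfl, h1, h2⟩
    exact_mod_cast (card_le_of_pairwise_lt_dist hd hε hε1 h1 h2).trans hr
  have hp0 : p 0 := ⟨∅, by simp⟩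
  obtain ⟨s, hs, h1, h2⟩ := Nat.findGreatest_spec (Nat.zero_le r) hp0
  refine ⟨s, hs.trans_le (Nat.findGreatest_le r), h1, fun v hv => ?_⟩
  by_contra! hcon
  have hvs : v ∉ s := fun h => by simpa [hε.not_gt] using hcon v h
  have hps : p (s.card + 1) := by
    refine ⟨insert v s, Finset.card_insert_of_notMem hvs, ?_, ?_⟩
    · simpa [hv] using h1
    · intro x hx y hy hxy
      rcases Finset.mem_insert.1 hx with rfl | hx' <;> rcases Finset.mem_insert.1 hy with rfl | hy
      · exact absurd rfl hxy
      · exact hcon y hy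
      · rw [dist_comm]; exact hcon x hx'
      · exact h2 x hx' y hy hxy
  have := Nat.le_findGreatest (hp _ hps) hps
  omega

/-- A ball contains a polytope with `r` vertices that nearly fills it. -/
lemma exists_polytope_closedBall (μ : Measure E) [μ.IsAddHaarMeasure]
    (hd : 2 ≤ Module.finrank ℝ E) {ε : ℝ} (hε : 0 < ε) (hε1 : ε ≤ 1) {r : ℕ}
    (hr : 2 * Module.finrank ℝ E * (2 / ε + 1) ^ (Module.finrank ℝ E - 1) ≤ (r : ℝ)) {ρ : ℝ}
    (hρ : 0 ≤ ρ) :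
    ∃ p : Fin r → E, (∀ i, p i ∈ Metric.closedBall (0 : E) ρ) ∧
      (1 - Module.finrank ℝ E * (ε ^ 2 / 2)) * μ.real (Metric.closedBall 0 ρ) ≤
        μ.real (convexHull ℝ (range p)) := by
  have : Nontrivial E := Module.nontrivial_of_finrank_pos (R := ℝ) (by omega)
  obtain ⟨s, hsr, hs, hnet⟩ := exists_finset_sphere_net hd hε hε1 hr
  obtain ⟨e, he⟩ := exists_norm_eq E (zero_le_one (α := ℝ))
  obtain ⟨x₀, hx₀, -⟩ := hnet e he
  have : Nonempty s := ⟨⟨x₀, hx₀⟩⟩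
  obtain ⟨g, hg⟩ : ∃ g : Fin r → s, Function.Surjective g := by
    obtain ⟨j⟩ : Nonempty (s ↪ Fin r) :=
      Function.Embedding.nonempty_of_card_le (by simpa using hsr)
    exact ⟨Function.invFun j, Function.invFun_surjective j.injective⟩
  have hrange : range (fun i => ρ • (g i : E)) = ρ • (s : Set E) := by
    ext y
    simp only [mem_range, mem_smul_set, Finset.mem_coe]
    constructor
    · rintro ⟨i, rfl⟩; exact ⟨g i, (g i).2, rfl⟩
    · rintro ⟨x, hx, rfl⟩
      obtain ⟨i, hi⟩ := hg ⟨x, hx⟩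
      exact ⟨i, by rw [hi]⟩
  refine ⟨fun i => ρ • (g i : E), fun i => ?_, ?_⟩
  · rw [mem_closedBall_zero_iff, norm_smul, hs _ (g i).2, Real.norm_of_nonneg hρ, mul_one]
  have hε2 : 0 ≤ 1 - ε ^ 2 / 2 := by nlinarith
  have hsub := smul_set_mono (a := ρ)
    (closedBall_subset_convexHull_of_net s.finite_toSet hs hnet)
  rw [smul_closedBall _ _ hε2, smul_zero, Real.norm_of_nonneg hρ, ← convexHull_smul, ← hrange]
    at hsub
  have hfin : μ (convexHull ℝ (range fun i => ρ • (g i : E))) ≠ ⊤ :=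
    ((finite_range _).isCompact_convexHull (𝕜 := ℝ)).measure_lt_top.ne
  refine le_trans ?_ (measureReal_mono hsub hfin)
  rw [μ.addHaar_real_closedBall 0 hρ, μ.addHaar_real_closedBall 0 (mul_nonneg hρ hε2), mul_pow]
  have hb := one_add_mul_le_pow (a := -(ε ^ 2 / 2)) (by linarith) (Module.finrank ℝ E)
  rw [← sub_eq_add_neg] at hb
  calc _ = (ρ ^ Module.finrank ℝ E * (1 + Module.finrank ℝ E * -(ε ^ 2 / 2))) *
          μ.real (Metric.ball 0 1) := by ring
    _ ≤ _ := by gcongr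

end Symmetrization

/-- **Lemma 2** : polytopal approximation of convex bodies. There is a dimension-free
constant `A` such that any convex body `C ⊆ ℝ^d` is approximated within
`A d |C| / r^{2/(d-1)}` in Nikodym distance by a polytope with at most `r` vertices. -/
theorem polytopal_approximation :
    ∃ A : ℝ, 0 < A ∧
      ∀ d : ℕ, 2 ≤ d →
      ∀ C : Set (EuclideanSpace ℝ (Fin d)),
        Convex ℝ C → IsCompact C → (interior C).Nonempty →
      ∀ r : ℕ, d + 1 ≤ r →
        ∃ V : Finset (EuclideanSpace ℝ (Fin d)), V.card ≤ r ∧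
          sdVol C (convexHull ℝ (V : Set (EuclideanSpace ℝ (Fin d))))
            ≤ A * d * (volume C).toReal / (r : ℝ) ^ (2 / ((d:ℝ) - 1)) := by
  refine ⟨145, by norm_num, fun d hd C hC hCc hCi r hr => ?_⟩
  have hd' : (2 : ℝ) ≤ d := by exact_mod_cast hd
  have hrpos : (0 : ℝ) < r := by exact_mod_cast (show 0 < r by omega)
  set q : ℝ := (r : ℝ) ^ (1 / ((d : ℝ) - 1)) with hq
  have hqpos : 0 < q := Real.rpow_pos_of_pos hrpos _
  have hq2 : (r : ℝ) ^ (2 / ((d : ℝ) - 1)) = q ^ 2 := by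
    rw [hq, ← Real.rpow_natCast, ← Real.rpow_mul hrpos.le]
    congr 1
    push_cast
    ring
  have hqd : q ^ (d - 1) = r := by
    rw [hq, ← Real.rpow_natCast, ← Real.rpow_mul hrpos.le, Nat.cast_sub (by omega), Nat.cast_one,
      one_div_mul_cancel (by linarith), Real.rpow_one]
  rw [hq2]
  have hCfin : volume C ≠ ⊤ := hCc.measure_lt_top.ne
  have hCpos : 0 < (volume C).toReal :=
    ENNReal.toReal_pos ((isOpen_interior.measure_pos volume hCi).trans_le
      (measure_mono interior_subset)).ne' hCfin
  rcases le_or_gt (q ^ 2) (145 * d) with hle | hlt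
  · refine ⟨∅, by simp, ?_⟩
    rw [le_div_iff₀ (by positivity)]
    rw [sdVol, Finset.coe_empty, convexHull_empty, ← bot_eq_empty, symmDiff_bot, mul_comm]
    gcongr
  set ε : ℝ := 12 / q with hε
  have hεpos : 0 < ε := by positivity
  have hε1 : ε ≤ 1 := by
    rw [hε, div_le_one hqpos]
    nlinarith
  have hfr : Module.finrank ℝ (EuclideanSpace ℝ (Fin d)) = d := by simp
  have hcount : 2 * (d : ℝ) * (2 / ε + 1) ^ (d - 1) ≤ r := by
    have h4 : 2 * (d : ℝ) ≤ 4 ^ (d - 1) := by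
      have h : ∀ k : ℕ, 2 * (k + 2) ≤ 4 ^ (k + 1) := fun k => by
        induction k with
        | zero => norm_num
        | succ k ih => rw [pow_succ]; omega
      obtain ⟨k, rfl⟩ := Nat.exists_eq_add_of_le' hd
      exact_mod_cast h k
    calc 2 * (d : ℝ) * (2 / ε + 1) ^ (d - 1) ≤ 4 ^ (d - 1) * (3 / ε) ^ (d - 1) := by
          gcongr
          rw [div_add_one hεpos.ne']
          gcongr
          linarith
      _ = q ^ (d - 1) := by
          rw [← mul_pow]
          congr 1
          rw [hε]
          field_simp
          norm_num
      _ = r := hqd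
  obtain ⟨p, hpC, hp⟩ : ∃ p : Fin r → EuclideanSpace ℝ (Fin d), (∀ i, p i ∈ C) ∧
      ENNReal.ofReal ((1 - 145 * d / q ^ 2) * (volume C).toReal)
        < volume (convexHull ℝ (range p)) := by
    by_contra! hcon
    have : Nontrivial (EuclideanSpace ℝ (Fin d)) :=
      Module.nontrivial_of_finrank_pos (R := ℝ) (by omega)
    obtain ⟨ρ, hρ, hball⟩ := PolytopeBounded.exists_closedBall (μ := volume) (ι := Fin r)
      ⟨hC, le_refl (volume C), hcon⟩ hCc (hCi.mono interior_subset)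
    obtain ⟨p, hpρ, hp⟩ := exists_polytope_closedBall (volume : Measure (EuclideanSpace ℝ (Fin d)))
      (by omega) hεpos hε1 (by rwa [hfr]) hρ
    have h1 := ENNReal.toReal_le_of_le_ofReal (by
      have : 145 * d / q ^ 2 < 1 := (div_lt_one (by positivity)).2 hlt
      exact mul_nonneg (by linarith) hCpos.le) (hball.hull_le p hpρ)
    have h2 := ENNReal.toReal_mono (isCompact_closedBall _ _).measure_lt_top.ne hball.le_measure
    have h3 : (d : ℝ) * (ε ^ 2 / 2) = 72 * (d / q ^ 2) := by rw [hε]; ring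
    rw [hfr, h3] at hp
    have h4 : 0 < (d : ℝ) / q ^ 2 := by positivity
    have h5 : 145 * ((d : ℝ) / q ^ 2) < 1 := by
      rw [← mul_div_assoc]; exact (div_lt_one (by positivity)).2 hlt
    have h6 : (1 - 72 * (d / q ^ 2)) * (volume C).toReal ≤
        (1 - 145 * d / q ^ 2) * (volume C).toReal :=
      (mul_le_mul_of_nonneg_left h2 (by linarith)).trans (hp.trans h1)
    rw [mul_div_assoc] at h6
    nlinarith
  classical
  refine ⟨Finset.univ.image p, Finset.card_image_le.trans (by simp), ?_⟩
  have hsub : convexHull ℝ (range p) ⊆ C :=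
    convexHull_min (range_subset_iff.2 hpC) hC
  have hm : MeasurableSet (convexHull ℝ (range p)) :=
    ((finite_range p).isCompact_convexHull (𝕜 := ℝ)).measurableSet
  have hpfin : volume (convexHull ℝ (range p)) ≠ ⊤ :=
    ((measure_mono hsub).trans_lt hCc.measure_lt_top).ne
  rw [Finset.coe_image, Finset.coe_univ, image_univ, sdVol, symmDiff_of_ge hsub]
  have h1 : (volume (C \ convexHull ℝ (range p))).toReal =
      (volume C).toReal - (volume (convexHull ℝ (range p))).toReal := by
    rw [measure_sdiff hsub hm.nullMeasurableSet hpfin,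
      ENNReal.toReal_sub_of_le (measure_mono hsub) hCfin]
  have h2 : (1 - 145 * d / q ^ 2) * (volume C).toReal ≤
      (volume (convexHull ℝ (range p))).toReal := (ENNReal.ofReal_le_iff_le_toReal hpfin).1 hp.le
  rw [h1, mul_div_right_comm]
  linarith
end
end
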